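/- Let F be a field and k ≤ n positive integers. The set of polynomials {π̄_w(x_{α,i}) : (α, i) ∈ A_{n,k}, w ∈ S_n, Des(α) ⊆ Des(w) ⊆ Des(α ∪ i)} descends to an F-vector space basis of S_{n,k} = F[x_1,…,x_n]/J_{n,k}; moreover each such polynomial π̄_w(x_{α,i}) is homogeneous of degree maj(α) + |i|, where |i| = i_1 + ⋯ + i_n. -/

import Mathlib

open scoped Classical
open MvPolynomial

noncomputable section

namespace OSPHecke

/-- Stirling numbers of the second kind. -/
def stirling : ℕ → ℕ → ℕ
  | 0, 0 => 1
  | 0, _ + 1 => 0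
  | _ + 1, 0 => 0
  | n + 1, k + 1 => stirling n k + (k + 1) * stirling n (k + 1)

/-- The `q`-analogue `[k]_q = 1 + q + ⋯ + q^{k-1}` as a polynomial in `q` over `ℕ`. -/
def qnat (k : ℕ) : Polynomial ℕ := ∑ t ∈ Finset.range k, Polynomial.X ^ t

/-- The `q`-factorial `[k]!_q`. -/
def qfact : ℕ → Polynomial ℕ
  | 0 => 1
  | k + 1 => qnat (k + 1) * qfact k

/-- The `q`-Stirling numbers `Stir_q(n,k)`, defined by
`Stir_q(n,k) = Stir_q(n-1,k-1) + [k]_q · Stir_q(n-1,k)` and `Stir_q(0,k) = δ_{0,k}`. -/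
def qstirling : ℕ → ℕ → Polynomial ℕ
  | 0, 0 => 1
  | 0, _ + 1 => 0
  | _ + 1, 0 => 0
  | n + 1, k + 1 => qstirling n k + qnat (k + 1) * qstirling n (k + 1)

variable (F : Type*) [Field F]

/-- The complete homogeneous symmetric polynomial of degree `d` in the first `m`
variables `x_1, …, x_m` of `F[x_1, …, x_n]` (variables are 0-indexed). -/
def hpoly (n d m : ℕ) : MvPolynomial (Fin n) F :=
  ∑ s ∈ Finset.univ.filter (fun s : Sym (Fin n) d => ∀ j ∈ s.1, (j : ℕ) < m),
    (s.1.map MvPolynomial.X).prod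

/-- The ideal `J_{n,k}` generated by `h_k(x_1), h_k(x_1,x_2), …, h_k(x_1,…,x_n)` and
`e_n(x_n), e_{n-1}(x_n), …, e_{n-k+1}(x_n)`. -/
def Jideal (n k : ℕ) : Ideal (MvPolynomial (Fin n) F) :=
  Ideal.span ({f | ∃ m, 1 ≤ m ∧ m ≤ n ∧ f = hpoly F n k m} ∪
    {f | ∃ d, n - k < d ∧ d ≤ n ∧ f = MvPolynomial.esymm (Fin n) F d})

/-- The neglex order on exponent vectors: `a < b` iff there is a position `j` with
`a j < b j` and `a l = b l` for all `l > j`. -/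
def NeglexLt {n : ℕ} (a b : Fin n → ℕ) : Prop :=
  ∃ j : Fin n, a j < b j ∧ ∀ l, j < l → a l = b l

/-- The value `w(t+1)` of a permutation at the 1-based position `t+1`
(0-based position `t`); extended by `0` outside the range. -/
def permVal {n : ℕ} (w : Equiv.Perm (Fin n)) (t : ℕ) : ℕ :=
  if h : t < n then (w ⟨t, h⟩ : ℕ) else 0

/-- The descent set of a permutation, recorded 1-based:
`Des(w) = {j ∈ [n-1] : w(j) > w(j+1)}`. -/
def permDes {n : ℕ} (w : Equiv.Perm (Fin n)) : Finset ℕ :=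
  (Finset.Ico 1 n).filter fun j => permVal w j < permVal w (j - 1)

/-- The inversion number (= Coxeter length) of a permutation. -/
def invCount {n : ℕ} (w : Equiv.Perm (Fin n)) : ℕ :=
  ((Finset.univ : Finset (Fin n × Fin n)).filter fun p => p.1 < p.2 ∧ w p.2 < w p.1).card

/-- The descent set (1-based) of a sequence `i = (i_1, i_2, …)`, given 0-based as
`i : ℕ → ℕ`: `Des(i) = {j ∈ [n-1] : i_j > i_{j+1}}`. -/
def seqDes (n : ℕ) (i : ℕ → ℕ) : Finset ℕ :=
  (Finset.Ico 1 n).filter fun j => i j < i (j - 1)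

/-- `α` is a composition of `n`. -/
def IsComposition (n : ℕ) (α : List ℕ) : Prop := α.sum = n ∧ ∀ a ∈ α, 0 < a

/-- The descent set of a composition: the partial sums `α_1, α_1+α_2, …`
excluding the total sum. -/
def desComp (α : List ℕ) : Finset ℕ :=
  ((Finset.range α.length).filter fun t => 0 < t).image fun t => (α.take t).sum

/-- The variable `x_{t+1}` (0-based index `t`), extended by `0` out of range. -/
def Xv (n : ℕ) (t : ℕ) : MvPolynomial (Fin n) F :=
  if h : t < n then MvPolynomial.X ⟨t, h⟩ else 0

/-- The adjacent transposition exchanging the 0-based indices `t` and `t+1`. -/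
def adjSwap (n t : ℕ) : Equiv.Perm (Fin n) :=
  if h : t + 1 < n then Equiv.swap ⟨t, Nat.lt_of_succ_lt h⟩ ⟨t + 1, h⟩ else 1

/-- `PibarRel F n t f g` says that `g = π̄_t(f)`, where (0-based indices `t`, `t+1`)
`π̄_t(f) = (x_{t+1}·(f - s_t(f)))/(x_t - x_{t+1}) = π_t(f) - f`; since `F[x]` is an
integral domain such a `g` is unique when it exists (and it always exists). -/
def PibarRel (n t : ℕ) (f g : MvPolynomial (Fin n) F) : Prop :=
  (Xv F n t - Xv F n (t + 1)) * g =
    Xv F n (t + 1) * (f - MvPolynomial.rename (⇑(adjSwap n t)) f)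

/-- The permutation associated to a word of (0-based) adjacent transposition indices. -/
def wordPerm (n : ℕ) (L : List ℕ) : Equiv.Perm (Fin n) := (L.map (adjSwap n)).prod

/-- `L` is a reduced word for `w`. -/
def IsReducedWord (n : ℕ) (L : List ℕ) (w : Equiv.Perm (Fin n)) : Prop :=
  (∀ t ∈ L, t + 1 < n) ∧ wordPerm n L = w ∧
    ∀ L' : List ℕ, (∀ t ∈ L', t + 1 < n) → wordPerm n L' = w → L.length ≤ L'.length

/-- `g` is a chain of successive applications of the operators `π̄` along the word `L`,
applied right-to-left (so `g (t+1) = π̄_{L.reverse[t]} (g t)`). -/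
def PibarChain (n : ℕ) (L : List ℕ) (g : ℕ → MvPolynomial (Fin n) F) : Prop :=
  ∀ t, t < L.length → PibarRel F n (L.reverse.getD t 0) (g t) (g (t + 1))

/-- `p = π̄_w(f)`, computed along some reduced word for `w`. -/
def IsPibarApplied (n : ℕ) (w : Equiv.Perm (Fin n)) (f p : MvPolynomial (Fin n) F) : Prop :=
  ∃ (L : List ℕ) (g : ℕ → MvPolynomial (Fin n) F),
    IsReducedWord n L w ∧ g 0 = f ∧ PibarChain F n L g ∧ g L.length = p

/-- The monomial `x_{α,i} = (∏_{j ∈ Des(α)} x_1⋯x_j) · x_1^{i_1}⋯x_n^{i_n}`. -/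
def xAI (n : ℕ) (α : List ℕ) (i : ℕ → ℕ) : MvPolynomial (Fin n) F :=
  (∏ j ∈ desComp α, ∏ t ∈ Finset.range j, Xv F n t) *
    ∏ t ∈ Finset.range n, Xv F n t ^ i t

/-- The defining conditions for the index set `A_{n,k}`: `α` is a composition of `n`
with `α_1 > n-k`, and `k - ℓ(α) ≥ i_1 ≥ ⋯ ≥ i_{n-k} ≥ 0 = i_{n-k+1} = ⋯ = i_n`
(the sequence `i` is 0-indexed: `i t` is the paper's `i_{t+1}`). -/
def Acond (n k : ℕ) (α : List ℕ) (i : ℕ → ℕ) : Prop :=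
  IsComposition n α ∧ n - k < α.headI ∧ i 0 + α.length ≤ k ∧
    (∀ a b, a ≤ b → b < n - k → i b ≤ i a) ∧ ∀ t, n - k ≤ t → i t = 0

/-- The exponent vector of the generalized Garsia–Stanton monomial `gs_{w,i}`:
the variable `x_{w(t)}` has exponent `#{d ∈ Des(w) : d ≥ t} + i_t` (1-based `t`). -/
def gsExp {n : ℕ} (w : Equiv.Perm (Fin n)) (i : ℕ → ℕ) : Fin n → ℕ := fun m =>
  ((permDes w).filter fun r => (w.symm m : ℕ) + 1 ≤ r).card + i (w.symm m : ℕ)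

/-- The generalized Garsia–Stanton monomial `gs_{w,i}`. -/
def gsMono (n : ℕ) (w : Equiv.Perm (Fin n)) (i : ℕ → ℕ) : MvPolynomial (Fin n) F :=
  ∏ m : Fin n, MvPolynomial.X m ^ gsExp w i m

/-- The condition `k - des(w) > i_1 ≥ ⋯ ≥ i_{n-k} ≥ 0 = i_{n-k+1} = ⋯ = i_n` defining
membership of `gs_{w,i}` in `GS_{n,k}`. -/
def GScond (n k : ℕ) (w : Equiv.Perm (Fin n)) (i : ℕ → ℕ) : Prop :=
  i 0 + (permDes w).card < k ∧ (∀ a b, a ≤ b → b < n - k → i b ≤ i a) ∧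
    ∀ t, n - k ≤ t → i t = 0

/-- An ordered set partition of `[n]` with `k` blocks: a `k`-tuple of nonempty,
pairwise disjoint subsets of `Fin n` covering `Fin n`. -/
def OSP (n k : ℕ) : Type :=
  {B : Fin k → Finset (Fin n) // (∀ j, (B j).Nonempty) ∧
    (∀ j l, j ≠ l → ∀ x, x ∈ B j → x ∉ B l) ∧ ∀ x, ∃ j, x ∈ B j}

/-- Relabelling the letters of an ordered set partition by a permutation. -/
def ospMap {n k : ℕ} (e : Equiv.Perm (Fin n)) (σ : OSP n k) : OSP n k :=
  ⟨fun j => (σ.1 j).image e, by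
    obtain ⟨h1, h2, h3⟩ := σ.2
    refine ⟨fun j => (h1 j).image e, fun j l hjl x hx hx' => ?_, fun x => ?_⟩
    · rcases Finset.mem_image.1 hx with ⟨y, hy, hey⟩
      rcases Finset.mem_image.1 hx' with ⟨y', hy', hey'⟩
      have : y = y' := e.injective (hey.trans hey'.symm)
      exact h2 j l hjl y hy (this ▸ hy')
    · rcases h3 (e.symm x) with ⟨j, hj⟩
      exact ⟨j, Finset.mem_image.2 ⟨e.symm x, hj, e.apply_symm_apply x⟩⟩⟩

/-- `b` lies in a block strictly to the left of the block of `a`. -/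
def leftOf {n k : ℕ} (σ : OSP n k) (a b : Fin n) : Prop :=
  ∃ p q : Fin k, p < q ∧ b ∈ σ.1 p ∧ a ∈ σ.1 q

/-- `a` and `b` lie in the same block. -/
def sameBlock {n k : ℕ} (σ : OSP n k) (a b : Fin n) : Prop :=
  ∃ p : Fin k, a ∈ σ.1 p ∧ b ∈ σ.1 p

/-- The value of the 0-Hecke generator `π` (for the pair of letters `a = i`,
`b = i+1`) on a basis element of `F[OP_{n,k}]`. -/
def heckeImg {n k : ℕ} (a b : Fin n) (σ : OSP n k) : OSP n k →₀ F :=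
  if leftOf σ a b then 0
  else if sameBlock σ a b then Finsupp.single σ 1
  else Finsupp.single σ 1 + Finsupp.single (ospMap (Equiv.swap a b) σ) 1

/-- The 0-Hecke operator `π` on `F[OP_{n,k}]` for the pair of letters `a = i`, `b = i+1`. -/
def heckeOp {n k : ℕ} (a b : Fin n) (f : OSP n k →₀ F) : OSP n k →₀ F :=
  f.sum fun σ c => c • heckeImg F a b σ

/-- The value of the 0-Hecke generator `π̄ = π - 1` on a basis element of `F[OP_{n,k}]`. -/
def pibarImg {n k : ℕ} (a b : Fin n) (σ : OSP n k) : OSP n k →₀ F :=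
  if leftOf σ a b then -Finsupp.single σ 1
  else if sameBlock σ a b then 0
  else Finsupp.single (ospMap (Equiv.swap a b) σ) 1

/-- The 0-Hecke operator `π̄ = π - 1` on `F[OP_{n,k}]`. -/
def pibarOp {n k : ℕ} (a b : Fin n) (f : OSP n k →₀ F) : OSP n k →₀ F :=
  f.sum fun σ c => c • pibarImg F a b σ

/-- `IsShuffle l₁ l₂ l` : `l` is an interleaving of `l₁` and `l₂` preserving the
relative order of the entries of each. -/
inductive IsShuffle : List ℕ → List ℕ → List ℕ → Prop
  | nil : IsShuffle [] [] []
  | left {a l₁ l₂ l} : IsShuffle l₁ l₂ l → IsShuffle (a :: l₁) l₂ (a :: l)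
  | right {a l₁ l₂ l} : IsShuffle l₁ l₂ l → IsShuffle l₁ (a :: l₂) (a :: l)

/-- An `(n,k)`-staircase: a shuffle of `(k-1, k-2, …, 1, 0)` with `n-k` copies of `k-1`. -/
def IsStaircase (n k : ℕ) (s : Fin n → ℕ) : Prop :=
  ∃ L : List ℕ, IsShuffle ((List.range k).reverse) (List.replicate (n - k) (k - 1)) L ∧
    ∀ j : Fin n, s j = L.getD (j : ℕ) 0

/-- `B` is an ordered set partition of `[n]` (`n = α.sum`) of shape `α`. -/
def IsOSPShape (α : List ℕ) (B : Fin α.length → Finset (Fin α.sum)) : Prop :=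
  (∀ j, (B j).card = α.get j) ∧
    (∀ j l, j ≠ l → ∀ x, x ∈ B j → x ∉ B l) ∧ ∀ x, ∃ j, x ∈ B j

/-- The ordered set partition `({1,…,α_1} | {α_1+1,…,α_1+α_2} | ⋯)` of shape `α`,
as a tuple of blocks. -/
def sigma0 (α : List ℕ) : Fin α.length → Finset (Fin α.sum) := fun j =>
  Finset.univ.filter fun x =>
    (α.take (j : ℕ)).sum ≤ (x : ℕ) ∧ (x : ℕ) < (α.take ((j : ℕ) + 1)).sum

section Shape

variable {n ℓ : ℕ}

/-- `b` lies in a block strictly to the left of the block of `a` (tuples of blocks). -/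
def blkLeft (B : Fin ℓ → Finset (Fin n)) (a b : Fin n) : Prop :=
  ∃ p q : Fin ℓ, p < q ∧ b ∈ B p ∧ a ∈ B q

/-- `a` and `b` lie in the same block (tuples of blocks). -/
def blkSame (B : Fin ℓ → Finset (Fin n)) (a b : Fin n) : Prop :=
  ∃ p : Fin ℓ, a ∈ B p ∧ b ∈ B p

/-- The value of the 0-Hecke generator `π` (for letters `a = i`, `b = i+1`) on a basis
element of the free module on tuples of blocks. -/
def shapeImg (a b : Fin n) (B : Fin ℓ → Finset (Fin n)) :
    (Fin ℓ → Finset (Fin n)) →₀ F :=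
  if blkLeft B a b then 0
  else if blkSame B a b then Finsupp.single B 1
  else Finsupp.single B 1 + Finsupp.single (fun j => (B j).image (Equiv.swap a b)) 1

/-- The 0-Hecke operator `π` on the free module on tuples of blocks. -/
def shapeOp (a b : Fin n) (f : (Fin ℓ → Finset (Fin n)) →₀ F) :
    (Fin ℓ → Finset (Fin n)) →₀ F :=
  f.sum fun B c => c • shapeImg F a b B

end Shape

/-- A `k`-tuple of blocks is an ordered set partition of `[n]` with `k` blocks. -/
def IsOSPFun {n k : ℕ} (B : Fin k → Finset (Fin n)) : Prop :=
  (∀ j, (B j).Nonempty) ∧ (∀ j l, j ≠ l → ∀ x, x ∈ B j → x ∉ B l) ∧ ∀ x, ∃ j, x ∈ B j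

/-- The `t`-th block (0-based) of a tuple of blocks, extended by `∅` out of range. -/
def blockExt {n k : ℕ} (B : Fin k → Finset (Fin n)) (t : ℕ) : Finset (Fin n) :=
  if h : t < k then B ⟨t, h⟩ else ∅

/-- The word (values in `{1, …, n}`) obtained by listing the elements of each block in
increasing order, reading the blocks from left to right. -/
def ospWord {n k : ℕ} (B : Fin k → Finset (Fin n)) : List ℕ :=
  (List.finRange k).flatMap fun j => ((B j).sort (· ≤ ·)).map fun x => (x : ℕ) + 1

/-- The major index of a word: the sum of the (1-based) positions `j` with
`L_j > L_{j+1}`. -/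
def wordMaj (L : List ℕ) : ℕ :=
  ∑ j ∈ Finset.range (L.length - 1), if L.getD (j + 1) 0 < L.getD j 0 then j + 1 else 0

/-- The major index of an ordered set partition `σ = (B_1 | ⋯ | B_k)`:
`maj(σ) = maj(w) + ∑_{i : max(B_i) < min(B_{i+1})} (α_1 + ⋯ + α_i - i)`. -/
def ospMaj {n k : ℕ} (B : Fin k → Finset (Fin n)) : ℕ :=
  wordMaj (ospWord B) +
    ∑ t ∈ Finset.range (k - 1),
      if ∀ a ∈ blockExt B t, ∀ b ∈ blockExt B (t + 1), a < b then
        (∑ j ∈ Finset.range (t + 1), (blockExt B j).card) - (t + 1)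
      else 0

/-- The complete homogeneous symmetric function of degree `d` evaluated at field
elements `v_1, …, v_n`. -/
def hval {n : ℕ} (v : Fin n → F) (d : ℕ) : F :=
  ∑ s ∈ (Finset.univ : Finset (Sym (Fin n) d)), (s.1.map v).prod

/-- The elementary symmetric function of degree `d` evaluated at field elements
`v_1, …, v_n` (it vanishes for `d > n`). -/
def esymval {n : ℕ} (v : Fin n → F) (d : ℕ) : F :=
  ∑ t ∈ Finset.powersetCard d Finset.univ, ∏ j ∈ t, v j

end OSPHecke

namespace OSPHecke

/-- The index set of the basis of Lemma "new-basis-lemma": triples `(α, i, w)` with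
`(α, i) ∈ A_{n,k}` and `Des(α) ⊆ Des(w) ⊆ Des(α ∪ i)`. -/
def Idx13 (n k : ℕ) : Type :=
  {q : List ℕ × (ℕ → ℕ) × Equiv.Perm (Fin n) //
    Acond n k q.1 q.2.1 ∧ desComp q.1 ⊆ permDes q.2.2 ∧
      permDes q.2.2 ⊆ desComp q.1 ∪ seqDes n q.2.1}

lemma adjSwap_of_lt {n t : ℕ} (h : t + 1 < n) :
    adjSwap n t = Equiv.swap ⟨t, Nat.lt_of_succ_lt h⟩ ⟨t + 1, h⟩ := by
  simp [adjSwap, h]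

lemma wordPerm_cons (n t : ℕ) (L : List ℕ) :
    wordPerm n (t :: L) = adjSwap n t * wordPerm n L := by
  simp [wordPerm]

/-- An adjacent transposition reverses the order of two values only when it exchanges them. -/
lemma adjSwap_lt_of_lt {n t : ℕ} (h : t + 1 < n) {a b : Fin n} (hab : a < b)
    (hne : ¬ ((a : ℕ) = t ∧ (b : ℕ) = t + 1)) : adjSwap n t a < adjSwap n t b := by
  rw [adjSwap_of_lt h]
  rw [Fin.lt_def] at hab ⊢
  simp only [Equiv.swap_apply_def, Fin.ext_iff]
  split_ifs <;> (try dsimp only) <;> omega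

/-- The strong exchange property for an inversion of the permutation of a word. -/
lemma exists_shorter_word {n : ℕ} : ∀ {L : List ℕ}, (∀ t ∈ L, t + 1 < n) →
    ∀ {p q : Fin n}, p < q → wordPerm n L q < wordPerm n L p →
      ∃ L' : List ℕ, (∀ t ∈ L', t + 1 < n) ∧ L'.length < L.length ∧
        wordPerm n L' = wordPerm n L * Equiv.swap p q
  | [], _, p, q, hpq, h => absurd h (by simpa [wordPerm] using hpq.le)
  | t :: L, hL, p, q, hpq, h => by
    have ht : t + 1 < n := hL t (by simp)
    have hL' : ∀ s ∈ L, s + 1 < n := fun s hs => hL s (by simp [hs])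
    rcases lt_trichotomy (wordPerm n L q) (wordPerm n L p) with hlt | heq | hgt
    · obtain ⟨M, hM, hlen, hMp⟩ := exists_shorter_word hL' hpq hlt
      refine ⟨t :: M, ?_, by simpa using hlen, ?_⟩
      · intro s hs
        rcases List.mem_cons.1 hs with rfl | hs
        exacts [ht, hM s hs]
      · rw [wordPerm_cons, wordPerm_cons, hMp, mul_assoc]
    · exact absurd ((wordPerm n L).injective heq) hpq.ne'
    · refine ⟨L, hL', by simp, ?_⟩
      have hval : ((wordPerm n L p : Fin n) : ℕ) = t ∧ ((wordPerm n L q : Fin n) : ℕ) = t + 1 := by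
        by_contra hne
        have := adjSwap_lt_of_lt ht hgt hne
        rw [wordPerm_cons] at h
        exact absurd h this.not_gt
      rw [wordPerm_cons, mul_assoc, Equiv.mul_swap_eq_swap_mul, ← mul_assoc, adjSwap_of_lt ht,
        show wordPerm n L p = ⟨t, Nat.lt_of_succ_lt ht⟩ from Fin.ext hval.1,
        show wordPerm n L q = ⟨t + 1, ht⟩ from Fin.ext hval.2, Equiv.swap_mul_self, one_mul]

lemma IsReducedWord.tail {n t : ℕ} {L : List ℕ} {w : Equiv.Perm (Fin n)}
    (h : IsReducedWord n (t :: L) w) : IsReducedWord n L (wordPerm n L) := by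
  obtain ⟨h1, h2, h3⟩ := h
  refine ⟨fun s hs => h1 s (by simp [hs]), rfl, fun M hM hMp => ?_⟩
  have := h3 (t :: M) ?_ (by rw [wordPerm_cons, hMp, ← wordPerm_cons, h2])
  · simpa using this
  · intro s hs
    rcases List.mem_cons.1 hs with rfl | hs
    exacts [h1 s (by simp), hM s hs]

/-- Prepending a letter to a reduced word, keeping it reduced, does not destroy inversions. -/
lemma IsReducedWord.inversion_cons {n t : ℕ} {L : List ℕ} {w : Equiv.Perm (Fin n)}
    (h : IsReducedWord n (t :: L) w) {p q : Fin n} (hpq : p < q)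
    (hinv : wordPerm n L q < wordPerm n L p) : w q < w p := by
  obtain ⟨h1, h2, h3⟩ := h
  have ht : t + 1 < n := h1 t (by simp)
  rw [← h2, wordPerm_cons]
  refine adjSwap_lt_of_lt ht hinv fun hval => ?_
  obtain ⟨M, hM, hlen, hMp⟩ :=
    exists_shorter_word (fun s hs => h1 s (by simp [hs])) hpq hinv
  have := h3 M hM ?_
  · simp at this
    omega
  · rw [hMp, ← h2, wordPerm_cons, Equiv.mul_swap_eq_swap_mul, adjSwap_of_lt ht,
      show wordPerm n L q = ⟨t, Nat.lt_of_succ_lt ht⟩ from Fin.ext hval.1,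
      show wordPerm n L p = ⟨t + 1, ht⟩ from Fin.ext hval.2, Equiv.swap_comm]

/-- The sum of the squares of the entries of an exponent vector. -/
def sqNorm {n : ℕ} (d : Fin n →₀ ℕ) : ℕ := ∑ j, d j ^ 2

lemma sqNorm_add {n : ℕ} (d e : Fin n →₀ ℕ) :
    sqNorm (d + e) = sqNorm d + 2 * ∑ j, d j * e j + sqNorm e := by
  simp only [sqNorm, Finset.mul_sum, ← Finset.sum_add_distrib]
  exact Finset.sum_congr rfl fun j _ => by simp only [Finsupp.add_apply]; ring

lemma sqNorm_equivMapDomain {n : ℕ} (w : Equiv.Perm (Fin n)) (d : Fin n →₀ ℕ) :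
    sqNorm (Finsupp.equivMapDomain w d) = sqNorm d := by
  simp only [sqNorm, Finsupp.equivMapDomain_apply]
  exact Equiv.sum_comp w.symm fun j => d j ^ 2

lemma degree_equivMapDomain {n : ℕ} (w : Equiv.Perm (Fin n)) (d : Fin n →₀ ℕ) :
    (Finsupp.equivMapDomain w d).degree = d.degree := by
  simp only [Finsupp.degree_eq_sum, Finsupp.equivMapDomain_apply]
  exact Equiv.sum_comp w.symm fun j => d j

/-- The exponent vector `b` with `p` and `q` added at the positions `i` and `j`. -/
def twoPoint {n : ℕ} (b : Fin n →₀ ℕ) (i j : Fin n) (p q : ℕ) : Fin n →₀ ℕ :=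
  b + Finsupp.single i p + Finsupp.single j q

lemma sqNorm_twoPoint {n : ℕ} {b : Fin n →₀ ℕ} {i j : Fin n} (hij : i ≠ j) (hi : b i = 0)
    (hj : b j = 0) (p q : ℕ) : sqNorm (twoPoint b i j p q) = sqNorm b + p ^ 2 + q ^ 2 := by
  have h1 : ∀ (l : Fin n) (r : ℕ), sqNorm (Finsupp.single l r) = r ^ 2 := fun l r => by
    rw [sqNorm, Finset.sum_eq_single l] <;> simp +contextual [eq_comm]
  have h2 : ∀ (d : Fin n →₀ ℕ) (l : Fin n) (r : ℕ),
      ∑ x, d x * Finsupp.single l r x = d l * r := fun d l r => by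
    rw [Finset.sum_eq_single l] <;> simp +contextual [eq_comm]
  rw [twoPoint, sqNorm_add, sqNorm_add, h1, h1, h2, h2]
  simp [hi, hj, hij]

lemma degree_twoPoint {n : ℕ} (b : Fin n →₀ ℕ) (i j : Fin n) (p q : ℕ) :
    (twoPoint b i j p q).degree = b.degree + p + q := by
  simp [twoPoint]

lemma twoPoint_erase {n : ℕ} {i j : Fin n} (hij : i ≠ j) (d : Fin n →₀ ℕ) :
    twoPoint ((d.erase i).erase j) i j (d i) (d j) = d := by
  ext l
  simp only [twoPoint, Finsupp.add_apply, Finsupp.erase_apply, Finsupp.single_apply]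
  by_cases h1 : l = i <;> by_cases h2 : l = j <;> simp_all [eq_comm]

lemma equivMapDomain_swap_twoPoint {n : ℕ} {b : Fin n →₀ ℕ} {i j : Fin n} (hij : i ≠ j)
    (hi : b i = 0) (hj : b j = 0) (p q : ℕ) :
    Finsupp.equivMapDomain (Equiv.swap i j) (twoPoint b i j p q) = twoPoint b i j q p := by
  ext l
  simp only [twoPoint, Finsupp.equivMapDomain_apply, Finsupp.add_apply, Finsupp.single_apply,
    Equiv.symm_swap, Equiv.swap_apply_def]
  by_cases h1 : l = i <;> by_cases h2 : l = j <;> simp_all [eq_comm] <;> omega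

section

variable {F : Type*} [Field F] {n : ℕ}

lemma monomial_twoPoint (b : Fin n →₀ ℕ) (i j : Fin n) (p q : ℕ) :
    (monomial (twoPoint b i j p q) 1 : MvPolynomial (Fin n) F) =
      monomial b 1 * X i ^ p * X j ^ q := by
  simp [twoPoint, X_pow_eq_monomial, monomial_mul]

lemma rename_monomial_equiv (w : Equiv.Perm (Fin n)) (d : Fin n →₀ ℕ) (a : F) :
    rename w (monomial d a) = monomial (Finsupp.equivMapDomain w d) a := by
  rw [rename_monomial, Finsupp.equivMapDomain_eq_mapDomain]

lemma Xv_of_lt {t : ℕ} (h : t < n) : Xv F n t = X ⟨t, h⟩ := by simp [Xv, h]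

lemma Xv_sub_ne_zero {t : ℕ} (h : t + 1 < n) : Xv F n t - Xv F n (t + 1) ≠ 0 := by
  rw [Xv_of_lt (Nat.lt_of_succ_lt h), Xv_of_lt h, sub_ne_zero]
  exact fun heq => by simpa using X_injective heq

/-- The leading term of `π̄_t` on a monomial, modulo monomials of smaller `sqNorm`. -/
def pibarLead (F : Type*) [Field F] {n : ℕ} (t : ℕ) (d : Fin n →₀ ℕ) : MvPolynomial (Fin n) F :=
  if h : t + 1 < n then
    if d ⟨t + 1, h⟩ < d ⟨t, Nat.lt_of_succ_lt h⟩ then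
      monomial (Finsupp.equivMapDomain (adjSwap n t) d) 1
    else if d ⟨t + 1, h⟩ = d ⟨t, Nat.lt_of_succ_lt h⟩ then 0 else -monomial d 1
  else 0

lemma exists_pibar_monomial {t : ℕ} (ht : t + 1 < n) (d : Fin n →₀ ℕ) :
    ∃ g : MvPolynomial (Fin n) F, PibarRel F n t (monomial d 1) g ∧
      g - pibarLead F t d ∈
        restrictSupport F {e | e.degree = d.degree ∧ sqNorm e < sqNorm d} := by
  set i : Fin n := ⟨t, Nat.lt_of_succ_lt ht⟩ with hi
  set j : Fin n := ⟨t + 1, ht⟩ with hj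
  have hij : i ≠ j := by simp [hi, hj]
  obtain ⟨b, hb⟩ : ∃ b, b = (d.erase i).erase j := ⟨_, rfl⟩
  have hbi : b i = 0 := by simp [hb, Finsupp.erase_apply]
  have hbj : b j = 0 := by simp [hb]
  have hd : d = twoPoint b i j (d i) (d j) := by rw [hb, twoPoint_erase hij]
  have hlead : pibarLead F t d = if d j < d i then
      monomial (Finsupp.equivMapDomain (Equiv.swap i j) d) 1
      else if d j = d i then 0 else -monomial d 1 := by
    rw [pibarLead, dif_pos ht, adjSwap_of_lt ht]
  have hren : rename (adjSwap n t) (monomial d (1 : F)) = monomial (twoPoint b i j (d j) (d i)) 1 := by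
    rw [rename_monomial_equiv, adjSwap_of_lt ht]
    conv_lhs => rw [hd]
    rw [equivMapDomain_swap_twoPoint hij hbi hbj]
  have hgeom : ∀ c r : ℕ, (X i - X j) * ∑ l ∈ Finset.range r,
        (monomial (twoPoint b i j (c + l) (c + r - l)) 1 : MvPolynomial (Fin n) F) =
      X j * (monomial (twoPoint b i j (c + r) c) 1 - monomial (twoPoint b i j c (c + r)) 1) := by
    intro c r
    have h1 : ∀ l ∈ Finset.range r, (monomial (twoPoint b i j (c + l) (c + r - l)) 1 :
        MvPolynomial (Fin n) F) =
        monomial b 1 * X i ^ c * X j ^ (c + 1) * (X i ^ l * X j ^ (r - 1 - l)) := by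
      intro l hl
      have hl := Finset.mem_range.1 hl
      rw [monomial_twoPoint, show c + r - l = c + 1 + (r - 1 - l) by omega]
      ring
    rw [Finset.sum_congr rfl h1, ← Finset.mul_sum]
    have h2 := (Commute.all (X i : MvPolynomial (Fin n) F) (X j)).geom_sum₂_mul r
    rw [monomial_twoPoint, monomial_twoPoint]
    linear_combination (monomial b 1 * X i ^ c * X j ^ (c + 1)) * h2
  have hlow : ∀ c r : ℕ, d.degree = b.degree + c + (c + (r + 1)) →
      sqNorm d = sqNorm b + c ^ 2 + (c + (r + 1)) ^ 2 →
      ∑ l ∈ Finset.range (r + 1),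
        (monomial (twoPoint b i j (c + l) (c + (r + 1) - l)) 1 : MvPolynomial (Fin n) F) -
        monomial (twoPoint b i j c (c + (r + 1))) 1 ∈
        restrictSupport F {e | e.degree = d.degree ∧ sqNorm e < sqNorm d} := by
    intro c r hdeg hsq
    rw [Finset.sum_range_succ', add_zero, Nat.sub_zero, add_sub_cancel_right]
    refine Submodule.sum_mem _ fun l hl => (monomial_mem_restrictSupport F).2 (Or.inl ⟨?_, ?_⟩)
    · have hl := Finset.mem_range.1 hl
      rw [degree_twoPoint, hdeg]
      omega
    · have hl := Finset.mem_range.1 hl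
      rw [sqNorm_twoPoint hij hbi hbj, hsq]
      obtain ⟨s, rfl⟩ : ∃ s, r = l + 1 + s := ⟨r - (l + 1), by omega⟩
      rw [show c + (l + 1 + s + 1) - (l + 1) = c + (s + 1) by omega]
      nlinarith [Nat.zero_le (l * s), Nat.zero_le (c * l)]
  have hdeg : d.degree = b.degree + d i + d j := by
    conv_lhs => rw [hd]
    rw [degree_twoPoint]
  have hsq : sqNorm d = sqNorm b + d i ^ 2 + d j ^ 2 := by
    conv_lhs => rw [hd]
    rw [sqNorm_twoPoint hij hbi hbj]
  have hmon : (monomial d 1 : MvPolynomial (Fin n) F) =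
      monomial (twoPoint b i j (d i) (d j)) 1 := by rw [← hd]
  simp only [PibarRel, Xv_of_lt ht, Xv_of_lt (Nat.lt_of_succ_lt ht), hren, hlead]
  rcases lt_trichotomy (d j) (d i) with h | h | h
  · obtain ⟨r, hr⟩ : ∃ r, d i = d j + (r + 1) := ⟨d i - d j - 1, by omega⟩
    refine ⟨_, (hgeom (d j) (r + 1)).trans (by rw [hmon, hr]), ?_⟩
    rw [if_pos h]
    conv in Finsupp.equivMapDomain _ d => rw [hd]
    rw [equivMapDomain_swap_twoPoint hij hbi hbj, hr]
    exact hlow _ _ (by omega) (by rw [hsq, hr]; ring)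
  · refine ⟨0, by rw [hmon, h]; simp, ?_⟩
    rw [if_neg h.not_lt, if_pos h, sub_zero]
    exact Submodule.zero_mem _
  · obtain ⟨r, hr⟩ : ∃ r, d j = d i + (r + 1) := ⟨d j - d i - 1, by omega⟩
    refine ⟨_, ((mul_neg _ _).trans (congrArg _ (hgeom (d i) (r + 1)))).trans
      (by rw [hmon, hr]; ring), ?_⟩
    rw [if_neg h.not_gt, if_neg h.ne', sub_neg_eq_add, ← Submodule.neg_mem_iff, neg_add, neg_neg,
      ← sub_eq_add_neg, hmon, hr]
    exact hlow _ _ (by omega) (by rw [hsq, hr])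

/-- The operator `π̄_t`, defined by its values on monomials. -/
def pibar (F : Type*) [Field F] (n t : ℕ) :
    MvPolynomial (Fin n) F →ₗ[F] MvPolynomial (Fin n) F :=
  (basisMonomials (Fin n) F).constr F fun d =>
    if h : t + 1 < n then (exists_pibar_monomial (F := F) h d).choose else 0

lemma pibar_monomial {t : ℕ} (ht : t + 1 < n) (d : Fin n →₀ ℕ) :
    pibar F n t (monomial d 1) = (exists_pibar_monomial (F := F) ht d).choose := by
  have := (basisMonomials (Fin n) F).constr_basis F (fun d =>
    if h : t + 1 < n then (exists_pibar_monomial (F := F) h d).choose else 0) d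
  rw [coe_basisMonomials, dif_pos ht] at this
  exact this

lemma pibar_monomial_sub_lead {t : ℕ} (ht : t + 1 < n) (d : Fin n →₀ ℕ) :
    pibar F n t (monomial d 1) - pibarLead F t d ∈
      restrictSupport F {e | e.degree = d.degree ∧ sqNorm e < sqNorm d} := by
  rw [pibar_monomial ht]
  exact (exists_pibar_monomial ht d).choose_spec.2

/-- A submodule of polynomials that contains `monomial d 1` for all exponents in the support
of `f` contains `f`. -/
lemma mem_of_monomial_mem (M : Submodule F (MvPolynomial (Fin n) F)) {f : MvPolynomial (Fin n) F}
    (h : ∀ d ∈ f.support, monomial d 1 ∈ M) : f ∈ M := by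
  rw [f.as_sum]
  refine Submodule.sum_mem _ fun d hd => ?_
  have := M.smul_mem (coeff d f) (h d hd)
  rwa [smul_monomial, smul_eq_mul, mul_one] at this

lemma pibarRel_pibar {t : ℕ} (ht : t + 1 < n) (f : MvPolynomial (Fin n) F) :
    PibarRel F n t f (pibar F n t f) := by
  let A : MvPolynomial (Fin n) F →ₗ[F] MvPolynomial (Fin n) F :=
    LinearMap.mulLeft F (Xv F n t - Xv F n (t + 1)) ∘ₗ pibar F n t
  let B : MvPolynomial (Fin n) F →ₗ[F] MvPolynomial (Fin n) F :=
    LinearMap.mulLeft F (Xv F n (t + 1)) ∘ₗ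
      (LinearMap.id - (rename (adjSwap n t) : MvPolynomial (Fin n) F →ₐ[F] _).toLinearMap)
  have hAB : A = B := by
    refine (basisMonomials (Fin n) F).ext fun d => ?_
    have h := (exists_pibar_monomial (F := F) ht d).choose_spec.1
    rw [← pibar_monomial ht] at h
    simpa [A, B, PibarRel] using h
  have := congrArg (fun T => T f) hAB
  simpa [A, B, PibarRel] using this

lemma PibarRel.eq_pibar {t : ℕ} (ht : t + 1 < n) {f g : MvPolynomial (Fin n) F}
    (h : PibarRel F n t f g) : g = pibar F n t f :=
  mul_left_cancel₀ (Xv_sub_ne_zero ht) (h.trans (pibarRel_pibar ht f).symm)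

lemma pibar_monomial_mem {t : ℕ} (ht : t + 1 < n) (d : Fin n →₀ ℕ) :
    pibar F n t (monomial d 1) ∈
      restrictSupport F {e | e.degree = d.degree ∧ sqNorm e ≤ sqNorm d} := by
  have h1 := restrictSupport_mono F (t := {e | e.degree = d.degree ∧ sqNorm e ≤ sqNorm d})
    (fun e he => ⟨he.1, he.2.le⟩) (pibar_monomial_sub_lead (F := F) ht d)
  have h2 : pibarLead F t d ∈
      restrictSupport F {e | e.degree = d.degree ∧ sqNorm e ≤ sqNorm d} := by
    rw [pibarLead, dif_pos ht]
    split_ifs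
    · refine (monomial_mem_restrictSupport F).2 (Or.inl ⟨?_, ?_⟩)
      · rw [degree_equivMapDomain]
      · rw [sqNorm_equivMapDomain]
    · exact Submodule.zero_mem _
    · exact Submodule.neg_mem _ ((monomial_mem_restrictSupport F).2 (Or.inl ⟨rfl, le_rfl⟩))
  simpa using Submodule.add_mem _ h1 h2

/-- The polynomials all of whose exponents have `sqNorm` less than `N`. -/
def lowSq (F : Type*) [Field F] (n N : ℕ) : Submodule F (MvPolynomial (Fin n) F) :=
  restrictSupport F {e | sqNorm e < N}

lemma pibar_mem_lowSq {t N : ℕ} (ht : t + 1 < n) {f : MvPolynomial (Fin n) F}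
    (hf : f ∈ lowSq F n N) : pibar F n t f ∈ lowSq F n N := by
  refine mem_of_monomial_mem ((lowSq F n N).comap (pibar F n t)) fun d hd => ?_
  refine restrictSupport_mono F ?_ (pibar_monomial_mem (F := F) ht d)
  exact fun e he => he.2.trans_lt (hf hd)

lemma pibar_isHomogeneous {t D : ℕ} (ht : t + 1 < n) {f : MvPolynomial (Fin n) F}
    (hf : f.IsHomogeneous D) : (pibar F n t f).IsHomogeneous D := by
  rw [← mem_homogeneousSubmodule]
  refine mem_of_monomial_mem ((homogeneousSubmodule (Fin n) F D).comap (pibar F n t))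
    fun d hd => ?_
  rw [Submodule.mem_comap, homogeneousSubmodule_eq_finsupp_supported]
  refine restrictSupport_mono F ?_ (pibar_monomial_mem (F := F) ht d)
  rintro e ⟨he, -⟩
  have h1 := hf (mem_support_iff.1 hd)
  have h2 : d.degree = Finsupp.weight 1 d := by
    rw [Finsupp.degree_eq_weight_one]
    rfl
  exact he.trans (h2.trans h1)

lemma pibar_monomial_sub_mem_lowSq {t : ℕ} (ht : t + 1 < n) {d : Fin n →₀ ℕ}
    (hd : d ⟨t + 1, ht⟩ < d ⟨t, Nat.lt_of_succ_lt ht⟩) :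
    pibar F n t (monomial d 1) - monomial (Finsupp.equivMapDomain (adjSwap n t) d) 1 ∈
      lowSq F n (sqNorm d) := by
  have := pibar_monomial_sub_lead (F := F) ht d
  rw [pibarLead, dif_pos ht, if_pos hd] at this
  exact restrictSupport_mono F (fun e he => he.2) this

lemma PibarChain.last {t : ℕ} {L : List ℕ} {g : ℕ → MvPolynomial (Fin n) F}
    (h : PibarChain F n (t :: L) g) : PibarRel F n t (g L.length) (g (L.length + 1)) := by
  have := h L.length (by simp)
  rwa [List.reverse_cons, List.getD_append_right _ _ _ _ (by simp), List.length_reverse,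
    Nat.sub_self, List.getD_cons_zero] at this

lemma PibarChain.tail {t : ℕ} {L : List ℕ} {g : ℕ → MvPolynomial (Fin n) F}
    (h : PibarChain F n (t :: L) g) : PibarChain F n L g := by
  intro s hs
  have := h s (by simp; omega)
  rwa [List.reverse_cons, List.getD_append _ _ _ _ (by simpa using hs)] at this

lemma PibarChain.isHomogeneous {D : ℕ} {g : ℕ → MvPolynomial (Fin n) F} :
    ∀ {L : List ℕ}, (∀ t ∈ L, t + 1 < n) → PibarChain F n L g →
      (g 0).IsHomogeneous D → (g L.length).IsHomogeneous D
  | [], _, _, h => h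
  | t :: L, hL, hg, h => by
    have ih := PibarChain.isHomogeneous (fun s hs => hL s (by simp [hs])) hg.tail h
    rw [List.length_cons, hg.last.eq_pibar (hL t (by simp))]
    exact pibar_isHomogeneous (hL t (by simp)) ih

/-- Along a reduced word of `w`, the operators `π̄` send the monomial with a weakly decreasing
exponent vector `c`, on whose level sets `w` is increasing, to the monomial with exponent
vector `w(c)`, up to monomials of smaller `sqNorm`. -/
lemma PibarChain.sub_monomial_mem_lowSq {c : Fin n →₀ ℕ} (hc : Antitone c)
    {g : ℕ → MvPolynomial (Fin n) F} (h0 : g 0 = monomial c 1) :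
    ∀ {L : List ℕ} {w : Equiv.Perm (Fin n)}, IsReducedWord n L w →
      (∀ p q, p < q → c p = c q → w p < w q) → PibarChain F n L g →
      g L.length - monomial (Finsupp.equivMapDomain w c) 1 ∈ lowSq F n (sqNorm c)
  | [], w, hw, _, _ => by
    have : w = 1 := by rw [← hw.2.1]; rfl
    subst this
    rw [List.length_nil, h0, show Finsupp.equivMapDomain (1 : Equiv.Perm (Fin n)) c = c from
      Finsupp.equivMapDomain_refl c, sub_self]
    exact Submodule.zero_mem _
  | t :: L, w, hw, hwc, hg => by
    have ht : t + 1 < n := hw.1 t (by simp)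
    set v := wordPerm n L with hv
    have hwv : w = adjSwap n t * v := by rw [← hw.2.1, wordPerm_cons]
    have hvc : ∀ p q, p < q → c p = c q → v p < v q := fun p q hpq hcpq => by
      by_contra hlt
      have hlt' : v q < v p := lt_of_le_of_ne (not_lt.1 hlt) (v.injective.ne hpq.ne')
      exact (hw.inversion_cons hpq hlt').not_gt (hwc p q hpq hcpq)
    have ih := PibarChain.sub_monomial_mem_lowSq hc h0 hw.tail hvc hg.tail
    set p := v.symm ⟨t, Nat.lt_of_succ_lt ht⟩ with hp
    set q := v.symm ⟨t + 1, ht⟩ with hq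
    have hvp : v p = ⟨t, Nat.lt_of_succ_lt ht⟩ := by simp [hp]
    have hvq : v q = ⟨t + 1, ht⟩ := by simp [hq]
    have hwqp : w q < w p := by
      rw [hwv, Equiv.Perm.mul_apply, Equiv.Perm.mul_apply, hvp, hvq, adjSwap_of_lt ht,
        Equiv.swap_apply_left, Equiv.swap_apply_right]
      simp [Fin.lt_def]
    have hpq : p < q := by
      by_contra hle
      have hne : q ≠ p := fun h => by rw [h] at hwqp; exact lt_irrefl _ hwqp
      have hlt : q < p := lt_of_le_of_ne (not_lt.1 hle) hne
      refine (hw.inversion_cons hlt ?_).not_gt hwqp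
      rw [← hv, hvp, hvq]
      simp [Fin.lt_def]
    have hcpq : c q < c p := lt_of_le_of_ne (hc hpq.le) fun h =>
      (hwc p q hpq h.symm).not_gt hwqp
    have hstep := pibar_monomial_sub_mem_lowSq (F := F) ht
      (d := Finsupp.equivMapDomain v c) (by simpa [Finsupp.equivMapDomain_apply] using hcpq)
    rw [sqNorm_equivMapDomain, ← Finsupp.equivMapDomain_trans] at hstep
    have hih := pibar_mem_lowSq ht ih
    rw [map_sub, ← hg.last.eq_pibar ht] at hih
    have := Submodule.add_mem _ hih hstep
    rw [sub_add_sub_cancel] at this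
    rw [hwv]
    exact this

end

section

variable {F : Type*} [Field F] {n : ℕ}

lemma multiset_map_X_prod (s : Multiset (Fin n)) :
    (s.map X).prod = (monomial (Multiset.toFinsupp s) 1 : MvPolynomial (Fin n) F) := by
  induction s using Multiset.induction_on with
  | empty => simp
  | cons a s ih =>
    rw [Multiset.map_cons, Multiset.prod_cons, ih, ← Multiset.singleton_add, map_add,
      Multiset.toFinsupp_singleton, X, monomial_mul, one_mul]

lemma coeff_hpoly (d m : ℕ) (c : Fin n →₀ ℕ) :
    coeff c (hpoly F n d m) = if c.degree = d ∧ ∀ j : Fin n, m ≤ j → c j = 0 then 1 else 0 := by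
  simp only [hpoly, coeff_sum, multiset_map_X_prod, coeff_monomial]
  have hmem : ∀ (j : Fin n), j ∈ Finsupp.toMultiset c ↔ c j ≠ 0 := fun j => by
    rw [Finsupp.mem_toMultiset, Finsupp.mem_support_iff]
  split_ifs with h
  · have hcard : (Finsupp.toMultiset c).card = d := by
      rw [Finsupp.card_toMultiset, ← h.1, Finsupp.degree_apply, Finsupp.sum]
      rfl
    rw [Finset.sum_eq_single ⟨Finsupp.toMultiset c, hcard⟩]
    · simp
    · intro s _ hs
      refine if_neg fun hsc => hs (Subtype.ext ?_)
      show s.1 = Finsupp.toMultiset c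
      rw [← hsc, Multiset.toFinsupp_toMultiset]
    · intro hs
      refine absurd (Finset.mem_filter.2 ⟨Finset.mem_univ _, fun j hj => ?_⟩) hs
      by_contra hle
      exact (hmem j).1 hj (h.2 j (not_lt.1 hle))
  · refine Finset.sum_eq_zero fun s hs => if_neg fun hsc => h ⟨?_, fun j hj => ?_⟩
    · have := Finsupp.card_toMultiset c
      rw [← hsc, Multiset.toFinsupp_toMultiset, s.2] at this
      rw [this, ← hsc, Finsupp.degree_apply, Finsupp.sum]
      rfl
    · by_contra hne
      have h1 := (hmem j).2 hne
      rw [← hsc, Multiset.toFinsupp_toMultiset] at h1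
      exact ((Finset.mem_filter.1 hs).2 j h1).not_ge hj

lemma hpoly_isHomogeneous (d m : ℕ) : (hpoly F n d m).IsHomogeneous d := by
  intro c hc
  rw [coeff_hpoly] at hc
  have h1 : c.degree = d := by
    by_contra hne
    exact hc (if_neg fun h => hne h.1)
  rw [← h1, Finsupp.degree_eq_weight_one]
  rfl

lemma hpoly_zero (m : ℕ) : hpoly F n 0 m = 1 := by
  ext c
  rw [coeff_hpoly, coeff_one]
  refine if_congr ⟨fun h => ?_, fun h => ?_⟩ rfl rfl
  · exact ((Finsupp.degree_eq_zero_iff c).1 h.1).symm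
  · subst h
    simp

lemma hpoly_succ_zero (d : ℕ) : hpoly F n (d + 1) 0 = 0 := by
  ext c
  rw [coeff_hpoly, coeff_zero]
  refine if_neg fun h => ?_
  have : c = 0 := by
    ext j
    exact h.2 j (Nat.zero_le _)
  simp [this] at h

lemma hpoly_succ_succ {m : ℕ} (hm : m < n) (d : ℕ) :
    hpoly F n (d + 1) (m + 1) =
      hpoly F n (d + 1) m + X ⟨m, hm⟩ * hpoly F n d (m + 1) := by
  ext c
  rw [coeff_add, coeff_X_mul', coeff_hpoly, coeff_hpoly, coeff_hpoly]
  by_cases hc : c ⟨m, hm⟩ = 0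
  · rw [if_neg (show ¬ ((⟨m, hm⟩ : Fin n) ∈ c.support) from by simpa using hc), add_zero]
    refine if_congr (and_congr_right fun _ => ⟨fun h j hj => ?_, fun h j hj => h j (by omega)⟩)
      rfl rfl
    rcases Nat.lt_or_ge m j with hlt | hge
    · exact h j hlt
    · rwa [show j = ⟨m, hm⟩ from Fin.ext (le_antisymm hge hj)]
  · rw [if_pos (show (⟨m, hm⟩ : Fin n) ∈ c.support from by simpa using hc),
      if_neg (show ¬ (c.degree = d + 1 ∧ ∀ j : Fin n, m ≤ (j : ℕ) → c j = 0) from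
        fun h => hc (h.2 ⟨m, hm⟩ le_rfl)), zero_add]
    obtain ⟨b, rfl⟩ : ∃ b, c = b + Finsupp.single ⟨m, hm⟩ 1 :=
      ⟨c - Finsupp.single ⟨m, hm⟩ 1, (tsub_add_cancel_of_le (by
        rw [Finsupp.single_le_iff]; omega)).symm⟩
    rw [add_tsub_cancel_right, map_add, Finsupp.degree_single]
    refine if_congr (and_congr (by omega) (forall_congr' fun j => imp_congr_right fun hj => ?_))
      rfl rfl
    have : (⟨m, hm⟩ : Fin n) ≠ j := fun h => by rw [← h] at hj; simp at hj
    simp [this]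

lemma rename_adjSwap_hpoly {t m : ℕ} (ht : t + 1 < n) (hm : m ≠ t + 1) (d : ℕ) :
    rename (adjSwap n t) (hpoly F n d m) = hpoly F n d m := by
  have hlt : ∀ j : Fin n, ((adjSwap n t j : Fin n) : ℕ) < m ↔ (j : ℕ) < m := by
    intro j
    rw [adjSwap_of_lt ht]
    simp only [Equiv.swap_apply_def, Fin.ext_iff]
    split_ifs <;> (try dsimp only) <;> omega
  ext c
  have hc : c = Finsupp.mapDomain (adjSwap n t)
      (Finsupp.equivMapDomain (adjSwap n t).symm c) := by
    rw [← Finsupp.equivMapDomain_eq_mapDomain, ← Finsupp.equivMapDomain_trans]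
    simp
  conv_lhs => rw [hc]
  rw [coeff_rename_mapDomain _ (adjSwap n t).injective, coeff_hpoly, coeff_hpoly,
    degree_equivMapDomain]
  refine if_congr (and_congr_right fun _ => ⟨fun h j hj => ?_, fun h j hj => ?_⟩) rfl rfl
  · have := h ((adjSwap n t).symm j) (by
      rw [← not_lt, ← hlt, Equiv.apply_symm_apply]; omega)
    simpa [Finsupp.equivMapDomain_apply] using this
  · rw [Finsupp.equivMapDomain_apply, Equiv.symm_symm]
    exact h _ (by rw [← not_lt, hlt]; omega)

lemma PibarRel.mul {t : ℕ} {f g f' g' : MvPolynomial (Fin n) F} (hf : PibarRel F n t f f')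
    (hg : PibarRel F n t g g') :
    PibarRel F n t (f * g) (f' * g + rename (adjSwap n t) f * g') := by
  unfold PibarRel at *
  rw [map_mul]
  linear_combination g * hf + rename (adjSwap n t) f * hg

lemma pibarRel_of_rename_eq {t : ℕ} {f : MvPolynomial (Fin n) F}
    (hf : rename (adjSwap n t) f = f) : PibarRel F n t f 0 := by
  rw [PibarRel, hf, sub_self, mul_zero, mul_zero]

/-- `π̄_t` sends `h_d(x_1, …, x_t)` to the difference of two consecutive such polynomials. -/
lemma pibarRel_hpoly {t : ℕ} (ht : t + 1 < n) (d : ℕ) :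
    PibarRel F n t (hpoly F n (d + 1) (t + 1))
      (hpoly F n (d + 1) (t + 1 + 1) - hpoly F n (d + 1) (t + 1)) := by
  have h1 := hpoly_succ_succ (F := F) ht d
  have h2 := congrArg (rename (adjSwap n t)) h1
  rw [map_add, map_mul, rename_adjSwap_hpoly ht (m := t + 1 + 1) (by omega) (d + 1),
    rename_adjSwap_hpoly ht (m := t + 1 + 1) (by omega) d, rename_X, adjSwap_of_lt ht, Equiv.swap_apply_right, ← adjSwap_of_lt ht] at h2
  rw [PibarRel, Xv_of_lt ht, Xv_of_lt (Nat.lt_of_succ_lt ht)]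
  linear_combination (X ⟨t, Nat.lt_of_succ_lt ht⟩) * h1 - X ⟨t + 1, ht⟩ * h2

lemma pibar_mem_Jideal {k t : ℕ} (hk : 1 ≤ k) (ht : t + 1 < n) {f : MvPolynomial (Fin n) F}
    (hf : f ∈ Jideal F n k) : pibar F n t f ∈ Jideal F n k := by
  suffices h : ∀ a, pibar F n t (a * f) ∈ Jideal F n k by simpa using h 1
  have hmul : ∀ (a : MvPolynomial (Fin n) F) {g g' : MvPolynomial (Fin n) F},
      PibarRel F n t g g' → g ∈ Jideal F n k → g' ∈ Jideal F n k →
      pibar F n t (a * g) ∈ Jideal F n k := fun a g g' h hg hg' => by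
    rw [← ((pibarRel_pibar ht a).mul h).eq_pibar ht]
    exact Ideal.add_mem _ (Ideal.mul_mem_left _ _ hg) (Ideal.mul_mem_left _ _ hg')
  unfold Jideal at hf
  induction hf using Submodule.span_induction with
  | mem g hg =>
    intro a
    have hgJ : g ∈ Jideal F n k := Ideal.subset_span hg
    rcases hg with ⟨m, hm1, hmn, rfl⟩ | ⟨d, hd, hdn, rfl⟩
    · by_cases hmt : m = t + 1
      · obtain ⟨d, rfl⟩ : ∃ d, k = d + 1 := ⟨k - 1, by omega⟩
        subst hmt
        exact hmul a (pibarRel_hpoly ht d) hgJ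
          (Ideal.sub_mem _ (Ideal.subset_span (Or.inl ⟨t + 2, by omega, by omega, rfl⟩)) hgJ)
      · exact hmul a (pibarRel_of_rename_eq (rename_adjSwap_hpoly ht hmt k)) hgJ
          (Ideal.zero_mem _)
    · exact hmul a (pibarRel_of_rename_eq (rename_esymm _ _ _ _)) hgJ (Ideal.zero_mem _)
  | zero => simp
  | add x y _ _ hx hy =>
    intro a
    rw [mul_add, map_add]
    exact Ideal.add_mem _ (hx a) (hy a)
  | smul b x _ hx =>
    intro a
    rw [smul_eq_mul, ← mul_assoc]
    exact hx _

/-- A monomial with an exponent at least `k` lies in `J_{n,k}` up to monomials of smaller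
`sqNorm`. -/
lemma monomial_mem_Jideal_sup_lowSq {k : ℕ} (hk : 1 ≤ k) :
    ∀ (j : ℕ) (hj : j < n) (c : Fin n →₀ ℕ), k ≤ c ⟨j, hj⟩ →
      (monomial c 1 : MvPolynomial (Fin n) F) ∈
        (Jideal F n k).restrictScalars F ⊔ lowSq F n (sqNorm c) := by
  intro j
  induction j with
  | zero =>
    intro hj c hc
    refine Submodule.mem_sup_left ?_
    have h1 : hpoly F n k 1 ∈ Jideal F n k :=
      Ideal.subset_span (Or.inl ⟨1, le_rfl, hj, rfl⟩)
    have h2 : ∀ d, hpoly F n d 1 = X ⟨0, hj⟩ ^ d := by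
      intro d
      induction d with
      | zero => rw [hpoly_zero, pow_zero]
      | succ d ih => rw [hpoly_succ_succ hj, hpoly_succ_zero, ih, zero_add, pow_succ']
    rw [h2] at h1
    have h3 : (monomial c 1 : MvPolynomial (Fin n) F) =
        monomial (c - Finsupp.single ⟨0, hj⟩ k) 1 * X ⟨0, hj⟩ ^ k := by
      rw [X_pow_eq_monomial, monomial_mul, one_mul,
        tsub_add_cancel_of_le (Finsupp.single_le_iff.2 hc)]
    rw [h3]
    exact Ideal.mul_mem_left _ _ h1
  | succ j ih =>
    intro hj c hc
    by_cases hle : c ⟨j + 1, hj⟩ ≤ c ⟨j, Nat.lt_of_succ_lt hj⟩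
    · exact ih (Nat.lt_of_succ_lt hj) c (hc.trans hle)
    · set d := Finsupp.equivMapDomain (adjSwap n j) c with hd
      have hd1 : d ⟨j + 1, hj⟩ = c ⟨j, Nat.lt_of_succ_lt hj⟩ := by
        rw [hd, Finsupp.equivMapDomain_apply, adjSwap_of_lt hj, Equiv.symm_swap,
          Equiv.swap_apply_right]
      have hd2 : d ⟨j, Nat.lt_of_succ_lt hj⟩ = c ⟨j + 1, hj⟩ := by
        rw [hd, Finsupp.equivMapDomain_apply, adjSwap_of_lt hj, Equiv.symm_swap,
          Equiv.swap_apply_left]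
      have hdc : Finsupp.equivMapDomain (adjSwap n j) d = c := by
        rw [hd, ← Finsupp.equivMapDomain_trans, adjSwap_of_lt hj]
        ext
        simp
      have hsq : sqNorm d = sqNorm c := sqNorm_equivMapDomain _ _
      have h1 := ih (Nat.lt_of_succ_lt hj) d (by rwa [hd2])
      have h2 := pibar_monomial_sub_mem_lowSq (F := F) hj (d := d) (by rw [hd1, hd2]; omega)
      rw [hdc, hsq] at h2
      rw [hsq] at h1
      obtain ⟨x, hx, y, hy, hxy⟩ := Submodule.mem_sup.1 h1
      have h3 : (monomial c 1 : MvPolynomial (Fin n) F) = pibar F n j x +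
          (pibar F n j y - (pibar F n j (monomial d 1) - monomial c 1)) := by
        rw [← hxy, map_add]
        ring
      rw [h3]
      exact Submodule.add_mem_sup (pibar_mem_Jideal hk hj hx)
        (Submodule.sub_mem _ (pibar_mem_lowSq hj hy) h2)

end

section

variable {F : Type*} [Field F] {n : ℕ}

/-- `w` is the permutation sorting the exponent vector `c` into decreasing order, stably. -/
def SortsDesc (c : Fin n → ℕ) (w : Equiv.Perm (Fin n)) : Prop :=
  Antitone (c ∘ w) ∧ ∀ p q, p < q → c (w p) = c (w q) → w p < w q

lemma exists_sortsDesc (c : Fin n → ℕ) : ∃ w, SortsDesc c w := by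
  have h := (Tuple.eq_sort_iff (f := OrderDual.toDual ∘ c)).1 rfl
  exact ⟨Tuple.sort (OrderDual.toDual ∘ c), fun p q hpq => h.1 hpq,
    fun p q hpq hc => h.2 p q hpq (congrArg OrderDual.toDual hc)⟩

/-- The entry `c (w t)`, extended by `0` to `t ≥ n`. -/
def sortedVal (c : Fin n → ℕ) (w : Equiv.Perm (Fin n)) (t : ℕ) : ℕ :=
  if h : t < n then c (w ⟨t, h⟩) else 0

lemma SortsDesc.sortedVal_antitone {c : Fin n → ℕ} {w : Equiv.Perm (Fin n)}
    (h : SortsDesc c w) : Antitone (sortedVal c w) := by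
  intro a b hab
  unfold sortedVal
  split_ifs with hb ha
  · exact h.1 (show (⟨a, ha⟩ : Fin n) ≤ ⟨b, hb⟩ from hab)
  · omega
  all_goals exact Nat.zero_le _

lemma permVal_of_lt (w : Equiv.Perm (Fin n)) {t : ℕ} (h : t < n) : permVal w t = w ⟨t, h⟩ := by
  simp [permVal, h]

lemma mem_permDes_iff {w : Equiv.Perm (Fin n)} {t : ℕ} :
    t ∈ permDes w ↔ 1 ≤ t ∧ ∃ h : t < n, w ⟨t, h⟩ < w ⟨t - 1, by omega⟩ := by
  rw [permDes, Finset.mem_filter, Finset.mem_Ico]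
  constructor
  · rintro ⟨⟨h1, h2⟩, h3⟩
    rw [permVal_of_lt w h2, permVal_of_lt w (by omega : t - 1 < n)] at h3
    exact ⟨h1, h2, h3⟩
  · rintro ⟨h1, h2, h3⟩
    rw [permVal_of_lt w h2, permVal_of_lt w (by omega : t - 1 < n)]
    exact ⟨⟨h1, h2⟩, h3⟩

lemma SortsDesc.lt_of_mem_permDes {c : Fin n → ℕ} {w : Equiv.Perm (Fin n)}
    (h : SortsDesc c w) {t : ℕ} (ht : t ∈ permDes w) :
    sortedVal c w t < sortedVal c w (t - 1) := by
  obtain ⟨h1, h2, h3⟩ := mem_permDes_iff.1 ht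
  refine lt_of_le_of_ne (h.sortedVal_antitone (Nat.sub_le _ _)) fun heq => ?_
  simp only [sortedVal, dif_pos h2, dif_pos (by omega : t - 1 < n)] at heq
  exact (h.2 ⟨t - 1, by omega⟩ ⟨t, h2⟩ (Fin.mk_lt_mk.2 (by omega)) heq.symm).not_gt h3

lemma sum_exchange {ι : Type*} [DecidableEq ι] {φ : ι → ℤ} {S T : Finset ι}
    (hcard : S.card = T.card) :
    ((∀ a ∈ T, ∀ b ∉ T, φ b ≤ φ a) → ∑ b ∈ S, φ b ≤ ∑ a ∈ T, φ a) ∧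
    ((∀ a ∈ T, ∀ b ∉ T, φ b < φ a) → S ≠ T → ∑ b ∈ S, φ b < ∑ a ∈ T, φ a) := by
  have hc : (S \ T).card = (T \ S).card := Finset.card_sdiff_comm hcard
  have e := Finset.equivOfCardEq hc
  have hS : ∑ b ∈ S, φ b = ∑ b ∈ S \ T, φ b + ∑ b ∈ S ∩ T, φ b :=
    (add_comm _ _).trans (Finset.sum_inter_add_sum_sdiff S T φ) |>.symm
  have hT : ∑ b ∈ T, φ b = ∑ b ∈ S \ T, φ (if h : b ∈ S \ T then e ⟨b, h⟩ else b) +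
      ∑ b ∈ S ∩ T, φ b := by
    rw [Finset.inter_comm, ← Finset.sum_inter_add_sum_sdiff T S φ, add_comm]
    congr 1
    rw [← Finset.sum_coe_sort (T \ S), ← Finset.sum_coe_sort (S \ T), ← e.sum_comp]
    refine Finset.sum_congr rfl fun b _ => ?_
    rw [dif_pos b.2]
  rw [hS, hT]
  constructor
  · intro h
    refine add_le_add_left (Finset.sum_le_sum fun b hb => ?_) _
    rw [dif_pos hb]
    exact h _ (Finset.mem_sdiff.1 (e ⟨b, hb⟩).2).1 _ (Finset.mem_sdiff.1 hb).2
  · intro h hne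
    have hne' : (S \ T).Nonempty := by
      rw [Finset.nonempty_iff_ne_empty, Ne, Finset.sdiff_eq_empty_iff_subset]
      exact fun hs => hne (Finset.eq_of_subset_of_card_le hs hcard.ge)
    refine add_lt_add_left (Finset.sum_lt_sum_of_nonempty hne' fun b hb => ?_) _
    rw [dif_pos hb]
    exact h _ (Finset.mem_sdiff.1 (e ⟨b, hb⟩).2).1 _ (Finset.mem_sdiff.1 hb).2

/-- The exponent vector of the squarefree monomial `∏_{j ∈ S} x_j`. -/
def indVec (S : Finset (Fin n)) : Fin n →₀ ℕ := ∑ i ∈ S, Finsupp.single i 1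

lemma indVec_apply (S : Finset (Fin n)) (j : Fin n) : indVec S j = if j ∈ S then 1 else 0 := by
  simp [indVec, Finsupp.finsetSum_apply, Finsupp.single_apply]

lemma sum_mul_indVec (S : Finset (Fin n)) (φ : Fin n → ℕ) :
    ∑ j, φ j * indVec S j = ∑ j ∈ S, φ j := by
  simp [indVec_apply]

lemma sqNorm_indVec (S : Finset (Fin n)) : sqNorm (indVec S) = S.card := by
  simp [sqNorm, indVec_apply]

/-- The sum `∑ j c_j`, used to break ties between exponent vectors. -/
def posSum (c : Fin n →₀ ℕ) : ℕ := ∑ j : Fin n, (j : ℕ) * c j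

lemma posSum_le (c : Fin n →₀ ℕ) : posSum c ≤ n * sqNorm c := by
  rw [posSum, sqNorm, Finset.mul_sum]
  exact Finset.sum_le_sum fun j _ => Nat.mul_le_mul j.2.le (Nat.le_self_pow two_ne_zero _)

lemma posSum_add (c d : Fin n →₀ ℕ) : posSum (c + d) = posSum c + posSum d := by
  simp [posSum, mul_add, Finset.sum_add_distrib]

lemma posSum_indVec (S : Finset (Fin n)) : posSum (indVec S) = ∑ j ∈ S, (j : ℕ) :=
  sum_mul_indVec S _

/-- If the sorted exponent vector has a jump exceeding the one forced by the descents, then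
`x^c` is congruent modulo `e_t` to a combination of smaller monomials. -/
lemma exists_esymm_reduction {c : Fin n →₀ ℕ} {w : Equiv.Perm (Fin n)} (h : SortsDesc c w)
    {t : ℕ} (ht0 : 1 ≤ t) (htn : t ≤ n)
    (hjump : sortedVal c w t + (if t ∈ permDes w then 1 else 0) < sortedVal c w (t - 1)) :
    ∃ (c' : Fin n →₀ ℕ) (T : Finset (Fin n)), T.card = t ∧ c = c' + indVec T ∧
      ∀ S : Finset (Fin n), S.card = t → S ≠ T →
        sqNorm (c' + indVec S) < sqNorm c ∨
          sqNorm (c' + indVec S) = sqNorm c ∧ posSum c < posSum (c' + indVec S) := by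
  set T : Finset (Fin n) := Finset.univ.filter fun j => (w.symm j : ℕ) < t with hTdef
  have hmem : ∀ j, j ∈ T ↔ (w.symm j : ℕ) < t := fun j => by simp [hTdef]
  have hval : ∀ j, c j = sortedVal c w (w.symm j) := fun j => by simp [sortedVal]
  have hanti := h.sortedVal_antitone
  have hTc : T.card = t := by
    have : T = (Finset.univ.filter fun p : Fin n => (p : ℕ) < t).map w.toEmbedding := by
      ext j
      simp [hmem, Finset.mem_map_equiv]
    rw [this, Finset.card_map, Fin.card_filter_val_lt, min_eq_right htn]
  have hge : ∀ a ∈ T, sortedVal c w (t - 1) ≤ c a := fun a ha => by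
    rw [hval]
    exact hanti (by have := (hmem a).1 ha; omega)
  have hle : ∀ b ∉ T, c b ≤ sortedVal c w t := fun b hb => by
    rw [hval]
    exact hanti (by have := (hmem b).not.1 hb; omega)
  have hcT : c = (c - indVec T) + indVec T := by
    refine (tsub_add_cancel_of_le fun j => ?_).symm
    rw [indVec_apply]
    split_ifs with hj
    · have := hge j hj; omega
    · exact Nat.zero_le _
  set c' := c - indVec T with hc'
  have hcmem : ∀ a ∈ T, c' a + 1 = c a := fun a ha => by
    conv_rhs => rw [hcT]
    simp [indVec_apply, ha]
  have hcnot : ∀ b ∉ T, c' b = c b := fun b hb => by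
    conv_rhs => rw [hcT]
    simp [indVec_apply, hb]
  have hcmp : ∀ a ∈ T, ∀ b ∉ T, c' b < c' a ∨ c' b = c' a ∧ a < b := by
    intro a ha b hb
    have h1 := hge a ha
    have h2 := hle b hb
    have h3 := hcmem a ha
    have h4 := hcnot b hb
    rcases Nat.lt_or_ge (c' b) (c' a) with hlt | hge'
    · exact Or.inl hlt
    · by_cases htd : t ∈ permDes w
      · rw [if_pos htd] at hjump; omega
      rw [if_neg htd] at hjump
      refine Or.inr ⟨by omega, ?_⟩
      have hbt := (hmem b).not.1 hb
      have hat := (hmem a).1 ha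
      have htn' : t < n := by have := (w.symm b).2; omega
      have ht1 : t - 1 < n := by omega
      have e1 : c (w ⟨t, htn'⟩) = c b := by
        have : sortedVal c w t = c b := by omega
        rwa [sortedVal, dif_pos htn'] at this
      have e2 : c (w ⟨t - 1, ht1⟩) = c a := by
        have : sortedVal c w (t - 1) = c a := by omega
        rwa [sortedVal, dif_pos ht1] at this
      have l1 : a ≤ w ⟨t - 1, ht1⟩ := by
        rcases Nat.lt_or_ge (w.symm a) (t - 1) with hl | hl
        · have := h.2 (w.symm a) ⟨t - 1, ht1⟩ hl (by rw [e2, Equiv.apply_symm_apply])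
          rw [Equiv.apply_symm_apply] at this
          exact this.le
        · rw [show (⟨t - 1, ht1⟩ : Fin n) = w.symm a from Fin.ext (by simp; omega),
            Equiv.apply_symm_apply]
      have l2 : w ⟨t, htn'⟩ ≤ b := by
        rcases Nat.lt_or_ge t (w.symm b) with hl | hl
        · have := h.2 ⟨t, htn'⟩ (w.symm b) hl (by rw [e1, Equiv.apply_symm_apply])
          rw [Equiv.apply_symm_apply] at this
          exact this.le
        · rw [show (⟨t, htn'⟩ : Fin n) = w.symm b from Fin.ext (by simp; omega),
            Equiv.apply_symm_apply]
      have l3 : w ⟨t - 1, ht1⟩ < w ⟨t, htn'⟩ := by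
        refine lt_of_le_of_ne (not_lt.1 fun hlt => htd (mem_permDes_iff.2 ⟨ht0, htn', hlt⟩)) ?_
        intro heq
        have := congrArg Fin.val (w.injective heq)
        simp only at this
        omega
      exact l1.trans_lt (l3.trans_le l2)
  refine ⟨c', T, hTc, hcT, fun S hS hST => ?_⟩
  have hcard : S.card = T.card := hS.trans hTc.symm
  have k1 := (sum_exchange (φ := fun j => (c' j : ℤ)) hcard).1 fun a ha b hb => by
    rcases hcmp a ha b hb with h | h <;> omega
  have k2 := (sum_exchange (φ := fun j => (n * c' j - j : ℤ)) hcard).2 (fun a ha b hb => by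
    have := a.2
    have := b.2
    rcases hcmp a ha b hb with h | ⟨h, h'⟩
    · have : (n : ℤ) * (c' b + 1) ≤ n * c' a :=
        mul_le_mul_of_nonneg_left (by omega) (by omega)
      rw [mul_add, mul_one] at this
      omega
    · simp only [h]
      have : (a : ℕ) < b := h'
      omega) hST
  rw [Finset.sum_sub_distrib, Finset.sum_sub_distrib, ← Finset.mul_sum, ← Finset.mul_sum] at k2
  rw [hcT, sqNorm_add, sqNorm_add, sum_mul_indVec, sum_mul_indVec, sqNorm_indVec, sqNorm_indVec,
    posSum_add, posSum_add, posSum_indVec, posSum_indVec, hcard]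
  rcases eq_or_lt_of_le k1 with heq | hlt
  · right
    rw [heq] at k2
    constructor
    · zify
      rw [heq]
    · zify
      linarith
  · left
    zify
    linarith

/-- A subspace containing `J_{n,k}` is everything as soon as it contains, up to lower terms,
the monomials whose sorted exponent vector drops beyond position `n - k` exactly at descents. -/
lemma eq_top_of_sorted_mem {k : ℕ} (hk : 1 ≤ k) (V : Submodule F (MvPolynomial (Fin n) F))
    (hJ : ∀ f ∈ Jideal F n k, f ∈ V)
    (hV : ∀ (c : Fin n →₀ ℕ) (w : Equiv.Perm (Fin n)), SortsDesc c w → (∀ j, c j < k) →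
      (∀ t, n - k < t → t ≤ n →
        sortedVal c w (t - 1) = sortedVal c w t + if t ∈ permDes w then 1 else 0) →
      ∃ f ∈ V, f - monomial c 1 ∈ lowSq F n (sqNorm c)) : V = ⊤ := by
  suffices h : ∀ N, ∀ r, ∀ c : Fin n →₀ ℕ, sqNorm c = N → n * N - posSum c = r →
      monomial c 1 ∈ V from
    eq_top_iff.2 fun f _ => mem_of_monomial_mem V fun d _ => h _ _ d rfl rfl
  intro N
  induction N using Nat.strong_induction_on with
  | _ N ihN =>
  have hlow : ∀ f ∈ lowSq F n N, f ∈ V := fun f hf =>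
    mem_of_monomial_mem V fun d hd => ihN _ (hf hd) _ d rfl rfl
  intro r
  induction r using Nat.strong_induction_on with
  | _ r ihr =>
  rintro c rfl rfl
  by_cases hB : ∃ j, k ≤ c j
  · obtain ⟨j, hj⟩ := hB
    have h1 := monomial_mem_Jideal_sup_lowSq (F := F) hk j j.2 c hj
    exact (sup_le (fun f hf => hJ f hf) hlow : _ ≤ V) h1
  push Not at hB
  obtain ⟨w, hw⟩ := exists_sortsDesc c
  by_cases hC : ∃ t, n - k < t ∧ t ≤ n ∧
      sortedVal c w t + (if t ∈ permDes w then 1 else 0) < sortedVal c w (t - 1)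
  · obtain ⟨t, ht1, ht2, ht3⟩ := hC
    obtain ⟨c', T, hT, hcT, hS⟩ := exists_esymm_reduction hw (by omega) ht2 ht3
    have h1 : monomial c' 1 * esymm (Fin n) F t ∈ V :=
      hJ _ (Ideal.mul_mem_left _ _ (Ideal.subset_span (Or.inr ⟨t, ht1, ht2, rfl⟩)))
    have hTm : T ∈ Finset.powersetCard t Finset.univ :=
      Finset.mem_powersetCard.2 ⟨Finset.subset_univ _, hT⟩
    rw [esymm_eq_sum_monomial, Finset.mul_sum, ← Finset.add_sum_erase _ _ hTm,
      monomial_mul, one_mul] at h1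
    rw [hcT]
    refine (Submodule.add_mem_iff_left _ (Submodule.sum_mem _ fun S hSm => ?_)).1 h1
    rw [monomial_mul, one_mul]
    obtain ⟨hne, hSm⟩ := Finset.mem_erase.1 hSm
    rcases hS S (Finset.mem_powersetCard.1 hSm).2 hne with h | ⟨h, h'⟩
    · exact ihN _ h _ _ rfl rfl
    · refine ihr _ ?_ _ h rfl
      have := posSum_le (c' + indVec S)
      change n * sqNorm c - posSum (c' + indVec S) < _
      rw [h] at this
      omega
  · push Not at hC
    obtain ⟨f, hf, hfc⟩ := hV c w hw hB fun t ht1 ht2 => by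
      refine le_antisymm (hC t ht1 ht2) ?_
      split_ifs with htd
      · exact hw.lt_of_mem_permDes htd
      · exact hw.sortedVal_antitone (Nat.sub_le _ _)
    have := V.sub_mem hf (hlow _ hfc)
    rwa [sub_sub_cancel] at this

end

section

variable {F : Type*} [Field F] {n : ℕ}

lemma desComp_singleton (a : ℕ) : desComp [a] = ∅ := by
  ext x
  simp [desComp]

lemma desComp_append_singleton {α : List ℕ} (hα : α ≠ []) (a : ℕ) :
    desComp (α ++ [a]) = insert α.sum (desComp α) := by
  have hpos := List.length_pos_iff.2 hα
  ext x
  simp only [desComp, Finset.mem_image, Finset.mem_filter, Finset.mem_range, List.length_append,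
    List.length_singleton, Finset.mem_insert]
  constructor
  · rintro ⟨t, ⟨ht, ht0⟩, rfl⟩
    rcases Nat.lt_succ_iff_lt_or_eq.1 ht with h | rfl
    · exact Or.inr ⟨t, ⟨h, ht0⟩, by rw [List.take_append_of_le_length h.le]⟩
    · left
      simp
  · rintro (rfl | ⟨t, ⟨ht, ht0⟩, rfl⟩)
    · exact ⟨α.length, ⟨by omega, hpos⟩, by simp⟩
    · exact ⟨t, ⟨by omega, ht0⟩, by rw [List.take_append_of_le_length ht.le]⟩

lemma headI_append_singleton {α : List ℕ} (hα : α ≠ []) (a : ℕ) :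
    (α ++ [a]).headI = α.headI := by
  cases α with
  | nil => exact absurd rfl hα
  | cons b l => rfl

lemma desComp_bounds {α : List ℕ} (hα : α ≠ []) (hpos : ∀ a ∈ α, 0 < a) :
    α.headI ≤ α.sum ∧ (∀ d ∈ desComp α, α.headI ≤ d ∧ d < α.sum) ∧
      α.length = (desComp α).card + 1 := by
  induction α using List.reverseRecOn with
  | nil => exact absurd rfl hα
  | append_singleton α a ih =>
    by_cases h : α = []
    · subst h
      simp [desComp_singleton]
    · obtain ⟨h0, h1, h2⟩ := ih h fun b hb => hpos b (by simp [hb])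
      have ha : 0 < a := hpos a (by simp)
      rw [desComp_append_singleton h, headI_append_singleton h, List.sum_append,
        List.sum_singleton, List.length_append, List.length_singleton,
        Finset.card_insert_of_notMem fun hm => (h1 _ hm).2.false, h2]
      refine ⟨by omega, fun d hd => ?_, rfl⟩
      rcases Finset.mem_insert.1 hd with rfl | hd
      · omega
      · have := h1 d hd
        omega

lemma IsComposition.ne_nil {α : List ℕ} (hn : 1 ≤ n) (hα : IsComposition n α) : α ≠ [] := by
  rintro rfl
  have := hα.1
  simp at this
  omega

lemma exists_composition (D : Finset ℕ) (hn : 1 ≤ n) (hD : D ⊆ Finset.Ico 1 n) :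
    ∃ α, IsComposition n α ∧ desComp α = D ∧ (α.headI ∈ D ∨ α.headI = n) := by
  induction D using Finset.induction_on_max generalizing n with
  | empty => exact ⟨[n], ⟨by simp, by simp; omega⟩, desComp_singleton n, Or.inr rfl⟩
  | insert m D hm ih =>
    have hmn := Finset.mem_Ico.1 (hD (Finset.mem_insert_self m D))
    obtain ⟨α, h1, h2, h3⟩ := ih hmn.1 fun x hx =>
      Finset.mem_Ico.2 ⟨(Finset.mem_Ico.1 (hD (Finset.mem_insert_of_mem hx))).1, hm x hx⟩
    have hne := h1.ne_nil hmn.1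
    refine ⟨α ++ [n - m], ⟨?_, fun a ha => ?_⟩, ?_, Or.inl ?_⟩
    · rw [List.sum_append, h1.1, List.sum_singleton]
      omega
    · rcases List.mem_append.1 ha with ha | ha
      · exact h1.2 a ha
      · rw [List.mem_singleton.1 ha]
        omega
    · rw [desComp_append_singleton hne, h1.1, h2]
    · rw [headI_append_singleton hne]
      rcases h3 with h | h
      · exact Finset.mem_insert_of_mem h
      · rw [h]
        exact Finset.mem_insert_self _ _

lemma IsComposition.eq_of_desComp_eq {α β : List ℕ} (hα : IsComposition n α)
    (hβ : IsComposition n β) (h : desComp α = desComp β) : α = β := by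
  induction α using List.reverseRecOn generalizing n β with
  | nil =>
    rcases β with _ | ⟨b, β⟩
    · rfl
    · have h1 := hα.1
      have h2 := hβ.1
      have h3 := hβ.2 b (by simp)
      simp at h1 h2
      omega
  | append_singleton α a ih =>
    have ha := hα.2 a (by simp)
    have hαs := hα.1
    rw [List.sum_append, List.sum_singleton] at hαs
    obtain ⟨β, b, rfl⟩ : ∃ β' b, β = β' ++ [b] :=
      (List.eq_nil_or_concat' β).resolve_left (hβ.ne_nil (by omega))
    have hb := hβ.2 b (by simp)
    have hβs := hβ.1
    rw [List.sum_append, List.sum_singleton] at hβs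
    have hαp : ∀ x ∈ α, 0 < x := fun x hx => hα.2 x (by simp [hx])
    have hβp : ∀ x ∈ β, 0 < x := fun x hx => hβ.2 x (by simp [hx])
    by_cases h1 : α = [] <;> by_cases h2 : β = []
    · subst h1 h2
      simp at hαs hβs
      rw [hαs, hβs]
    · subst h1
      rw [desComp_append_singleton h2, List.nil_append, desComp_singleton] at h
      exact absurd h.symm (Finset.insert_ne_empty _ _)
    · subst h2
      rw [desComp_append_singleton h1, List.nil_append, desComp_singleton] at h
      exact absurd h (Finset.insert_ne_empty _ _)
    · rw [desComp_append_singleton h1, desComp_append_singleton h2] at h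
      have b1 := (desComp_bounds h1 hαp).2.1
      have b2 := (desComp_bounds h2 hβp).2.1
      have hs : α.sum = β.sum := by
        have m1 : α.sum ∈ insert β.sum (desComp β) := h ▸ Finset.mem_insert_self _ _
        have m2 : β.sum ∈ insert α.sum (desComp α) := h ▸ Finset.mem_insert_self _ _
        rcases Finset.mem_insert.1 m1 with m1 | m1
        · exact m1
        · rcases Finset.mem_insert.1 m2 with m2 | m2
          · exact m2.symm
          · exact absurd (b1 _ m2).2 (b2 _ m1).2.not_gt
      have hd : desComp α = desComp β := by
        have := congrArg (fun s => s.erase α.sum) h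
        rw [Finset.erase_insert fun hm => (b1 _ hm).2.false, hs,
          Finset.erase_insert fun hm => (b2 _ hm).2.false] at this
        exact this
      rw [ih ⟨rfl, hαp⟩ ⟨hs.symm, hβp⟩ hd, show a = b by omega]

/-- The exponent vector of `(∏_{j ∈ D} x_1⋯x_j) · x^i`. -/
def xExp (n : ℕ) (D : Finset ℕ) (i : ℕ → ℕ) : Fin n →₀ ℕ :=
  Finsupp.equivFunOnFinite.symm fun t => (D.filter fun d => (t : ℕ) < d).card + i t

lemma xAI_eq_monomial {α : List ℕ} (i : ℕ → ℕ) (h : ∀ d ∈ desComp α, d ≤ n) :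
    xAI F n α i = monomial (xExp n (desComp α) i) 1 := by
  have hX : ∀ t : Fin n, Xv F n t = X t := fun t => Xv_of_lt t.2
  have h1 : ∀ j ∈ desComp α, ∏ t ∈ Finset.range j, Xv F n t =
      ∏ t : Fin n, X t ^ (if (t : ℕ) < j then 1 else 0) := fun j hj => by
    have h2 : ∀ t : Fin n, (X t : MvPolynomial (Fin n) F) ^ (if (t : ℕ) < j then 1 else 0) =
        Xv F n t ^ (if (t : ℕ) < j then 1 else 0) := fun t => by rw [hX]
    rw [Finset.prod_congr rfl fun t _ => h2 t,
      Fin.prod_univ_eq_prod_range (fun t => Xv F n t ^ (if t < j then 1 else 0)) n,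
      ← Finset.prod_subset (Finset.range_mono (h j hj)) fun t _ ht => by
        rw [if_neg (by simpa using ht), pow_zero]]
    exact Finset.prod_congr rfl fun t ht => by rw [if_pos (Finset.mem_range.1 ht), pow_one]
  rw [xAI, Finset.prod_congr rfl h1, Finset.prod_comm, Finset.prod_range, ← Finset.prod_mul_distrib,
    monomial_eq, C_1, one_mul, Finsupp.prod_fintype _ _ (by simp)]
  refine Finset.prod_congr rfl fun t _ => ?_
  rw [Finset.prod_pow_eq_pow_sum, hX, ← pow_add, ← Finset.card_filter]
  rfl

lemma xAI_isHomogeneous (α : List ℕ) (i : ℕ → ℕ) :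
    (xAI F n α i).IsHomogeneous ((∑ j ∈ desComp α, j) + ∑ t ∈ Finset.range n, i t) := by
  have hX : ∀ t, (Xv F n t).IsHomogeneous 1 := fun t => by
    unfold Xv
    split_ifs
    · exact isHomogeneous_X _ _
    · exact isHomogeneous_zero _ _ _
  refine (IsHomogeneous.prod _ _ _ fun j _ => ?_).mul (IsHomogeneous.prod _ _ _ fun t _ => ?_)
  · simpa using IsHomogeneous.prod (Finset.range j) _ (fun _ => 1) fun t _ => hX t
  · simpa using (hX t).pow (i t)

end

section

variable {F : Type*} [Field F] {n : ℕ}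

lemma card_filter_lt_eq (D : Finset ℕ) (t : ℕ) :
    (D.filter fun d => t < d).card =
      (D.filter fun d => t + 1 < d).card + if t + 1 ∈ D then 1 else 0 := by
  have h : (D.filter fun d => t < d) =
      (D.filter fun d => t + 1 < d) ∪ if t + 1 ∈ D then {t + 1} else ∅ := by
    ext x
    split_ifs with ht
    · simp only [Finset.mem_filter, Finset.mem_union, Finset.mem_singleton]
      constructor
      · rintro ⟨h1, h2⟩
        rcases Nat.lt_or_ge (t + 1) x with h | h
        · exact Or.inl ⟨h1, h⟩
        · exact Or.inr (by omega)
      · rintro (⟨h1, h2⟩ | rfl)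
        · exact ⟨h1, by omega⟩
        · exact ⟨ht, by omega⟩
    · simp only [Finset.mem_filter, Finset.union_empty]
      refine and_congr_right fun hx => ⟨fun h => ?_, fun h => by omega⟩
      rcases Nat.lt_or_ge (t + 1) x with h' | h'
      · exact h'
      · exact absurd (by rwa [show t + 1 = x by omega]) ht
  rw [h, Finset.card_union_of_disjoint]
  · split_ifs <;> simp
  · split_ifs
    · simp
    · exact Finset.disjoint_empty_right _

lemma lt_of_mem_permDes {w : Equiv.Perm (Fin n)} {t : ℕ} (h : t ∈ permDes w) : t < n :=
  (mem_permDes_iff.1 h).2.1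

/-- A sorted exponent vector dropping beyond position `n - k` exactly at the descents of the
sorting permutation comes from an element of the index set. -/
lemma exists_idx {k : ℕ} (hk : 1 ≤ k) (hkn : k ≤ n) {c : Fin n →₀ ℕ} {w : Equiv.Perm (Fin n)}
    (hw : SortsDesc c w) (hck : ∀ j, c j < k)
    (hdrop : ∀ t, n - k < t → t ≤ n →
      sortedVal c w (t - 1) = sortedVal c w t + if t ∈ permDes w then 1 else 0) :
    ∃ p : Idx13 n k, p.1.2.2 = w ∧
      xAI F n p.1.1 p.1.2.1 = monomial (Finsupp.equivMapDomain w.symm c) 1 := by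
  set lam := sortedVal c w with hlam
  have hanti : Antitone lam := hw.sortedVal_antitone
  set D := (permDes w).filter fun d => n - k < d with hD
  have hDmem : ∀ t, n - k < t → (t ∈ D ↔ t ∈ permDes w) := fun t ht => by
    rw [hD, Finset.mem_filter, and_iff_left ht]
  have hDn : ∀ d ∈ D, d < n := fun d hd => lt_of_mem_permDes (Finset.mem_filter.1 hd).1
  have hcnt : ∀ s, s ≤ k → (D.filter fun d => n - s < d).card = lam (n - s) := by
    intro s
    induction s with
    | zero =>
      intro _
      rw [Nat.sub_zero, hlam, sortedVal, dif_neg (lt_irrefl _), Finset.card_eq_zero,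
        Finset.filter_eq_empty_iff]
      exact fun d hd => (hDn d hd).not_gt
    | succ s ih =>
      intro hs
      have h1 : n - (s + 1) + 1 = n - s := by omega
      have h2 := hdrop (n - s) (by omega) (by omega)
      rw [card_filter_lt_eq, h1, ih (by omega), if_congr (hDmem _ (by omega)) rfl rfl, ← h2]
      congr 1
  have hDcard : D.card = lam (n - k) := by
    rw [← hcnt k le_rfl, Finset.filter_true_of_mem fun d hd => (Finset.mem_filter.1 hd).2]
  set i : ℕ → ℕ := fun t => if t < n - k then lam t - lam (n - k) else 0 with hi
  obtain ⟨α, hα, hαD, hhead⟩ := exists_composition D (hk.trans hkn) fun d hd =>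
    Finset.mem_Ico.2 ⟨(mem_permDes_iff.1 (Finset.mem_filter.1 hd).1).1, hDn d hd⟩
  have hlen := (desComp_bounds (hα.ne_nil (hk.trans hkn)) hα.2).2.2
  have hlamk : ∀ t, lam t < k := fun t => by
    rw [hlam, sortedVal]
    split_ifs
    · exact hck _
    · omega
  refine ⟨⟨(α, i, w), ⟨hα, ?_, ?_, fun a b hab hb => ?_, fun t ht => ?_⟩, ?_, ?_⟩, rfl, ?_⟩
  · rcases hhead with h | h
    · exact (Finset.mem_filter.1 h).2
    · simp only [h]
      omega
  · simp only [hlen, hαD, hDcard, hi]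
    have := hlamk 0
    have := hlamk (n - k)
    have := hanti (Nat.zero_le (n - k))
    split_ifs <;> omega
  · simp only [hi]
    rw [if_pos hb, if_pos (by omega)]
    exact Nat.sub_le_sub_right (hanti hab) _
  · simp only [hi]
    rw [if_neg (by omega)]
  · rw [hαD]
    exact Finset.filter_subset _ _
  · intro t ht
    rw [Finset.mem_union]
    rcases Nat.lt_or_ge (n - k) t with h | h
    · exact Or.inl (by rw [hαD]; exact (hDmem t h).2 ht)
    · right
      have h1 := (mem_permDes_iff.1 ht).1
      have h2 : lam t < lam (t - 1) := hw.lt_of_mem_permDes ht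
      have h3 : lam (n - k) ≤ lam t := hanti h
      rw [seqDes, Finset.mem_filter, Finset.mem_Ico]
      refine ⟨⟨h1, lt_of_mem_permDes ht⟩, ?_⟩
      simp only [hi]
      rw [if_pos (show t - 1 < n - k by omega)]
      split_ifs <;> omega
  · rw [xAI_eq_monomial _ (by rw [hαD]; exact fun d hd => (hDn d hd).le)]
    refine congrArg (fun e => monomial e 1) (Finsupp.ext fun t => ?_)
    rw [Finsupp.equivMapDomain_apply, Equiv.symm_symm]
    have hlt : c (w t) = lam t := by simp [hlam, sortedVal]
    change ((desComp α).filter fun d => (t : ℕ) < d).card + i t = _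
    rw [hαD, hlt]
    simp only [hi]
    split_ifs with h
    · rw [Finset.filter_true_of_mem fun d hd => h.trans (Finset.mem_filter.1 hd).2, hDcard]
      have := hanti h.le
      omega
    · have := hcnt (n - t) (by omega)
      rw [show n - (n - (t : ℕ)) = t by omega] at this
      rw [this, add_zero]

/-- The polynomials `π̄_w(x_{α,i})` span modulo `J_{n,k}`. -/
lemma span_sup_Jideal_eq_top {k : ℕ} (hk : 1 ≤ k) (hkn : k ≤ n)
    (P : Idx13 n k → MvPolynomial (Fin n) F)
    (hP : ∀ p : Idx13 n k, IsPibarApplied F n p.1.2.2 (xAI F n p.1.1 p.1.2.1) (P p)) :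
    Submodule.span F (Set.range P) ⊔ (Jideal F n k).restrictScalars F = ⊤ := by
  refine eq_top_of_sorted_mem hk _ (fun f hf => Submodule.mem_sup_right hf)
    fun c w hw hck hdrop => ?_
  obtain ⟨p, rfl, hpx⟩ := exists_idx (F := F) hk hkn hw hck hdrop
  obtain ⟨L, g, hL, hg0, hg, hgP⟩ := hP p
  refine ⟨P p, Submodule.mem_sup_left (Submodule.subset_span ⟨p, rfl⟩), ?_⟩
  have happ : ∀ t, Finsupp.equivMapDomain p.1.2.2.symm c t = c (p.1.2.2 t) := fun t => by
    rw [Finsupp.equivMapDomain_apply, Equiv.symm_symm]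
  have h := hg.sub_monomial_mem_lowSq (c := Finsupp.equivMapDomain p.1.2.2.symm c)
    (fun a b hab => by rw [happ, happ]; exact hw.1 hab) (hg0.trans hpx) hL
    (fun a b hab heq => by
      rw [happ, happ] at heq
      exact hw.2 a b hab heq)
  rwa [hgP, sqNorm_equivMapDomain, ← Finsupp.equivMapDomain_trans, Equiv.symm_trans_self,
    Finsupp.equivMapDomain_refl] at h

end

section

variable {n k : ℕ}

/-- The number of elements of `E` that are at most `t`. -/
def rankIn (E : Finset ℕ) (t : ℕ) : ℕ := (E.filter fun c => c ≤ t).card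

lemma rankIn_succ (E : Finset ℕ) (t : ℕ) :
    rankIn E (t + 1) = rankIn E t + if t + 1 ∈ E then 1 else 0 := by
  have h : (E.filter fun c => c ≤ t + 1) =
      if t + 1 ∈ E then insert (t + 1) (E.filter fun c => c ≤ t) else E.filter fun c => c ≤ t := by
    ext x
    split_ifs with ht
    · simp only [Finset.mem_filter, Finset.mem_insert]
      constructor
      · rintro ⟨h1, h2⟩
        by_cases h : x = t + 1
        · exact Or.inl h
        · exact Or.inr ⟨h1, by omega⟩
      · rintro (rfl | ⟨h1, h2⟩)
        · exact ⟨ht, le_rfl⟩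
        · exact ⟨h1, by omega⟩
    · simp only [Finset.mem_filter]
      refine and_congr_right fun hx => ⟨fun h => ?_, fun h => by omega⟩
      have : x ≠ t + 1 := fun h' => ht (h' ▸ hx)
      omega
  rw [rankIn, h]
  split_ifs
  · rw [Finset.card_insert_of_notMem (by simp)]
    rfl
  · rfl

lemma exists_rankIn_eq {E : Finset ℕ} (h0 : rankIn E 0 = 0) {v t : ℕ} (hv : v ≤ rankIn E t) :
    ∃ s ≤ t, rankIn E s = v := by
  induction t with
  | zero => exact ⟨0, le_rfl, by omega⟩
  | succ t ih =>
    by_cases h : v ≤ rankIn E t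
    · obtain ⟨s, hs, hsv⟩ := ih h
      exact ⟨s, by omega, hsv⟩
    · refine ⟨t + 1, le_rfl, ?_⟩
      rw [rankIn_succ] at hv ⊢
      split_ifs at hv ⊢ <;> omega

lemma rankIn_le_card (E : Finset ℕ) (t : ℕ) : rankIn E t ≤ E.card :=
  Finset.card_filter_le _ _

/-- Permutations with a choice of `n - k` non-descents are at most as many as surjections
`[n] → [k]`: merge the positions at the chosen non-descents. -/
lemma card_sigma_le_card_surjective (hk : 1 ≤ k) (hkn : k ≤ n) :
    ((Finset.univ : Finset (Equiv.Perm (Fin n))).sigma fun w =>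
        (Finset.Ico 1 n \ permDes w).powersetCard (n - k)).card ≤
      Nat.card {f : Fin n → Fin k // Function.Surjective f} := by
  obtain ⟨n, rfl⟩ : ∃ m, n = m + 1 := ⟨n - 1, by omega⟩
  rw [Nat.card_eq_fintype_card, Fintype.card_subtype]
  set E : Finset ℕ → Finset ℕ := fun D => Finset.Ico 1 (n + 1) \ D with hE
  have hE0 : ∀ D, rankIn (E D) 0 = 0 := fun D => by
    rw [rankIn, Finset.card_eq_zero, Finset.filter_eq_empty_iff]
    intro x hx
    have := (Finset.mem_Ico.1 (Finset.mem_sdiff.1 hx).1).1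
    omega
  have key : ∀ (w : Equiv.Perm (Fin (n + 1))) (D : Finset ℕ),
      D ∈ (Finset.Ico 1 (n + 1) \ permDes w).powersetCard (n + 1 - k) →
      (E D).card = k - 1 ∧ rankIn (E D) n = k - 1 ∧
        StrictMono fun t : Fin (n + 1) => toLex (rankIn (E D) t, w t) := by
    intro w D hD
    obtain ⟨hDs, hDc⟩ := Finset.mem_powersetCard.1 hD
    have hcard : (E D).card = k - 1 := by
      rw [hE, Finset.card_sdiff_of_subset (hDs.trans Finset.sdiff_subset), Nat.card_Ico, hDc]
      omega
    refine ⟨hcard, ?_, Fin.strictMono_iff_lt_succ.2 fun t => ?_⟩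
    · rw [← hcard, rankIn, Finset.filter_true_of_mem]
      intro x hx
      have := (Finset.mem_Ico.1 (Finset.mem_sdiff.1 hx).1).2
      omega
    · rw [Prod.Lex.toLex_lt_toLex]
      simp only [Fin.val_castSucc, Fin.val_succ, rankIn_succ]
      by_cases ht : (t : ℕ) + 1 ∈ E D
      · left
        rw [if_pos ht]
        omega
      · right
        rw [if_neg ht]
        refine ⟨rfl, lt_of_le_of_ne (not_lt.1 fun hlt => ht ?_)
          (w.injective.ne (Fin.castSucc_lt_succ).ne)⟩
        refine Finset.mem_sdiff.2 ⟨Finset.mem_Ico.2 ⟨by omega, by omega⟩, fun hmem => ?_⟩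
        exact (Finset.mem_sdiff.1 (hDs hmem)).2
          (mem_permDes_iff.2 ⟨by omega, by omega, hlt⟩)
  have hlt : ∀ (w : Equiv.Perm (Fin (n + 1))) (D : Finset ℕ),
      D ∈ (Finset.Ico 1 (n + 1) \ permDes w).powersetCard (n + 1 - k) → ∀ t,
      min (rankIn (E D) t) (k - 1) = rankIn (E D) t := fun w D hD t =>
    min_eq_left ((rankIn_le_card _ _).trans (key w D hD).1.le)
  refine Finset.card_le_card_of_injOn
    (fun p x => ⟨min (rankIn (E p.2) (p.1.symm x)) (k - 1), by omega⟩) ?_ ?_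
  · rintro ⟨w, D⟩ hp
    have hD := (Finset.mem_sigma.1 hp).2
    refine Finset.mem_coe.2 (Finset.mem_filter.2 ⟨Finset.mem_univ _, fun v => ?_⟩)
    obtain ⟨s, hs, hsv⟩ := exists_rankIn_eq (E := E D) (hE0 D) (v := v) (t := n) (by
      rw [(key w D hD).2.1]; omega)
    refine ⟨w ⟨s, by omega⟩, Fin.ext ?_⟩
    simp only [Equiv.symm_apply_apply]
    rw [hlt w D hD, hsv]
  · rintro ⟨w, D⟩ hp ⟨w', D'⟩ hp' heq
    have hD := (Finset.mem_sigma.1 hp).2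
    have hD' := (Finset.mem_sigma.1 hp').2
    have hf : ∀ x, rankIn (E D) (w.symm x) = rankIn (E D') (w'.symm x) := fun x => by
      have := congrArg Fin.val (congrFun heq x)
      simp only at this
      rwa [hlt w D hD, hlt w' D' hD'] at this
    have hrange : ∀ (v : Equiv.Perm (Fin (n + 1))) (B : Finset ℕ),
        Set.range (fun t : Fin (n + 1) => toLex (rankIn (E B) t, v t)) =
          Set.range fun x : Fin (n + 1) => toLex (rankIn (E B) (v.symm x), x) := fun v B => by
      rw [← v.symm.surjective.range_comp]
      simp [Function.comp_def]
    have h := ((key w D hD).2.2.range_inj (key w' D' hD').2.2).1 (by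
      rw [hrange, hrange]
      simp only [hf])
    have h' : ∀ t : Fin (n + 1), rankIn (E D) t = rankIn (E D') t ∧ w t = w' t := fun t =>
      Prod.ext_iff.1 (toLex.injective (congrFun h t))
    have hw : w = w' := Equiv.ext fun t => (h' t).2
    have hstep : ∀ B : Finset ℕ, B ⊆ Finset.Ico 1 (n + 1) → ∀ c, c ∈ B ↔
        c ∈ Finset.Ico 1 (n + 1) ∧ rankIn (E B) c = rankIn (E B) (c - 1) := by
      intro B hB c
      constructor
      · intro hc
        have hc' := Finset.mem_Ico.1 (hB hc)
        obtain ⟨c, rfl⟩ : ∃ d, c = d + 1 := ⟨c - 1, by omega⟩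
        refine ⟨hB hc, ?_⟩
        rw [rankIn_succ, if_neg fun hm => (Finset.mem_sdiff.1 hm).2 hc]
        rfl
      · rintro ⟨hc, hr⟩
        have hc' := Finset.mem_Ico.1 hc
        obtain ⟨c, rfl⟩ : ∃ d, c = d + 1 := ⟨c - 1, by omega⟩
        by_contra hcB
        rw [rankIn_succ, if_pos (Finset.mem_sdiff.2 ⟨hc, hcB⟩), Nat.add_sub_cancel] at hr
        omega
    have hDD : D = D' := by
      ext c
      rw [hstep D ((Finset.mem_powersetCard.1 hD).1.trans Finset.sdiff_subset),
        hstep D' ((Finset.mem_powersetCard.1 hD').1.trans Finset.sdiff_subset)]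
      refine and_congr_right fun hc => ?_
      have hc' := Finset.mem_Ico.1 hc
      have e1 := (h' ⟨c, hc'.2⟩).1
      have e2 := (h' ⟨c - 1, by omega⟩).1
      simp only at e1 e2
      rw [e1, e2]
    subst hw hDD
    rfl

end

section

variable {n k : ℕ}

lemma Idx13.desComp_eq (hk : 1 ≤ k) (hkn : k ≤ n) (p : Idx13 n k) :
    desComp p.1.1 = (permDes p.1.2.2).filter fun d => n - k < d := by
  obtain ⟨⟨α, i, w⟩, ⟨hα, hhead, -, -, hi0⟩, h1, h2⟩ := p
  have hb := (desComp_bounds (hα.ne_nil (hk.trans hkn)) hα.2).2.1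
  ext d
  rw [Finset.mem_filter]
  refine ⟨fun hd => ⟨h1 hd, hhead.trans_le (hb d hd).1⟩, fun ⟨hd, hkd⟩ => ?_⟩
  refine (Finset.mem_union.1 (h2 hd)).resolve_right fun hs => ?_
  have := (Finset.mem_filter.1 hs).2
  rw [hi0 (d - 1) (by omega)] at this
  omega

/-- The number of descents `d ≤ m` of `w` with `t < d`. -/
def smallDes (w : Equiv.Perm (Fin n)) (m t : ℕ) : ℕ :=
  (((permDes w).filter fun d => d ≤ m).filter fun d => t < d).card

lemma Idx13.apply_succ_add_le (hk : 1 ≤ k) (hkn : k ≤ n) (p : Idx13 n k) {t : ℕ}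
    (ht : t < n - k) :
    p.1.2.1 (t + 1) + (if t + 1 ∈ permDes p.1.2.2 then 1 else 0) ≤ p.1.2.1 t := by
  obtain ⟨⟨α, i, w⟩, ⟨hα, hhead, -, hanti, hi0⟩, h1, h2⟩ := p
  have hb := (desComp_bounds (hα.ne_nil (hk.trans hkn)) hα.2).2.1
  simp only
  split_ifs with hd
  · rcases Finset.mem_union.1 (h2 hd) with hs | hs
    · have : α.headI ≤ t + 1 := (hb _ hs).1
      simp only at hhead
      omega
    · exact (Finset.mem_filter.1 hs).2
  · rcases Nat.lt_or_ge (t + 1) (n - k) with h | h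
    · exact hanti t (t + 1) (by omega) h
    · have : i (t + 1) = 0 := hi0 _ h
      omega

lemma smallDes_eq (w : Equiv.Perm (Fin n)) {m t : ℕ} (ht : t < m) :
    smallDes w m t = smallDes w m (t + 1) + if t + 1 ∈ permDes w then 1 else 0 := by
  rw [smallDes, card_filter_lt_eq]
  refine congrArg _ (if_congr ?_ rfl rfl)
  rw [Finset.mem_filter, and_iff_left (show t + 1 ≤ m from ht)]

lemma smallDes_of_le (w : Equiv.Perm (Fin n)) {m t : ℕ} (ht : m ≤ t) : smallDes w m t = 0 := by
  rw [smallDes, Finset.card_eq_zero, Finset.filter_eq_empty_iff]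
  intro d hd
  have := (Finset.mem_filter.1 hd).2
  omega

lemma Idx13.smallDes_le (hk : 1 ≤ k) (hkn : k ≤ n) (p : Idx13 n k) (t : ℕ) :
    smallDes p.1.2.2 (n - k) t ≤ p.1.2.1 t := by
  rcases Nat.lt_or_ge (n - k) t with ht | ht
  · rw [smallDes_of_le _ ht.le]
    exact Nat.zero_le _
  · induction ht using Nat.decreasingInduction with
    | self =>
      rw [smallDes_of_le _ le_rfl]
      exact Nat.zero_le _
    | of_succ t ht ih =>
      rw [smallDes_eq _ ht]
      exact (Nat.add_le_add_right ih _).trans (p.apply_succ_add_le hk hkn ht)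

/-- The sequence `i` with the contribution of the small descents of `w` removed. -/
def Idx13.excess (p : Idx13 n k) (t : ℕ) : ℕ := p.1.2.1 t - smallDes p.1.2.2 (n - k) t

lemma Idx13.excess_antitone (hk : 1 ≤ k) (hkn : k ≤ n) (p : Idx13 n k) : Antitone p.excess := by
  refine antitone_nat_of_succ_le fun t => ?_
  unfold Idx13.excess
  rcases Nat.lt_or_ge t (n - k) with ht | ht
  · have h1 := p.apply_succ_add_le hk hkn ht
    rw [smallDes_eq _ ht]
    omega
  · have : p.1.2.1 (t + 1) = 0 := p.2.1.2.2.2.2 _ (by omega)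
    omega

lemma Idx13.excess_zero_add_lt (hk : 1 ≤ k) (hkn : k ≤ n) (p : Idx13 n k) :
    p.excess 0 + (permDes p.1.2.2).card < k := by
  have h1 := p.2.1.2.2.1
  rw [(desComp_bounds (p.2.1.1.ne_nil (hk.trans hkn)) p.2.1.1.2).2.2, p.desComp_eq hk hkn] at h1
  have h2 := p.smallDes_le hk hkn 0
  have h3 : smallDes p.1.2.2 (n - k) 0 =
      ((permDes p.1.2.2).filter fun d => d ≤ n - k).card := by
    rw [smallDes, Finset.filter_true_of_mem]
    exact fun d hd => (mem_permDes_iff.1 (Finset.mem_filter.1 hd).1).1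
  have h4 := Finset.card_filter_add_card_filter_not (s := permDes p.1.2.2) fun d => d ≤ n - k
  simp only [not_le] at h4
  unfold Idx13.excess
  omega

/-- The subset encoding the sequence `i` of an element of the index set. -/
def Idx13.code (p : Idx13 n k) : Finset ℕ :=
  (Finset.univ : Finset (Fin (n - k))).image fun t : Fin (n - k) => p.excess t + (n - k - 1 - t)

lemma Idx13.code_strictAnti (hk : 1 ≤ k) (hkn : k ≤ n) (p : Idx13 n k) :
    StrictAnti fun t : Fin (n - k) => p.excess t + (n - k - 1 - t) := by
  intro s t hst
  have h1 := p.excess_antitone hk hkn hst.le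
  have h2 : (s : ℕ) < t := hst
  have := t.2
  simp only
  omega

lemma Idx13.code_mem (hk : 1 ≤ k) (hkn : k ≤ n) (p : Idx13 n k) :
    p.code ∈ (Finset.range (n - 1 - (permDes p.1.2.2).card)).powersetCard (n - k) := by
  refine Finset.mem_powersetCard.2 ⟨fun x hx => ?_, ?_⟩
  · obtain ⟨t, -, rfl⟩ := Finset.mem_image.1 hx
    have h1 := p.excess_antitone hk hkn (Nat.zero_le t)
    have h2 := p.excess_zero_add_lt hk hkn
    have := t.2
    rw [Finset.mem_range]
    omega
  · rw [Idx13.code, Finset.card_image_of_injective _ (p.code_strictAnti hk hkn).injective,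
      Finset.card_univ, Fintype.card_fin]

lemma Idx13.eq_of_code_eq (hk : 1 ≤ k) (hkn : k ≤ n) {p q : Idx13 n k}
    (hw : p.1.2.2 = q.1.2.2) (hc : p.code = q.code) : p = q := by
  have h1 : (fun t : Fin (n - k) => p.excess t + (n - k - 1 - t)) =
      fun t : Fin (n - k) => q.excess t + (n - k - 1 - t) := by
    refine ((p.code_strictAnti hk hkn).range_inj (q.code_strictAnti hk hkn)).1 ?_
    have := congrArg (fun s : Finset ℕ => (s : Set ℕ)) hc
    simpa [Idx13.code] using this
  have hi : p.1.2.1 = q.1.2.1 := by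
    ext t
    rcases Nat.lt_or_ge t (n - k) with ht | ht
    · have h2 := congrFun h1 ⟨t, ht⟩
      have h3 := p.smallDes_le hk hkn t
      have h4 := q.smallDes_le hk hkn t
      simp only [Idx13.excess, hw] at h2 h3
      omega
    · rw [p.2.1.2.2.2.2 t ht, q.2.1.2.2.2.2 t ht]
  have hα : p.1.1 = q.1.1 := p.2.1.1.eq_of_desComp_eq q.2.1.1 (by
    rw [p.desComp_eq hk hkn, q.desComp_eq hk hkn, hw])
  exact Subtype.ext (Prod.ext hα (Prod.ext hi hw))

lemma finite_idx_and_card_le (hk : 1 ≤ k) (hkn : k ≤ n) :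
    Finite (Idx13 n k) ∧
      Nat.card (Idx13 n k) ≤ Nat.card {f : Fin n → Fin k // Function.Surjective f} := by
  set A := (Finset.univ : Finset (Equiv.Perm (Fin n))).sigma fun w =>
    (Finset.range (n - 1 - (permDes w).card)).powersetCard (n - k) with hA
  let e : Idx13 n k → A := fun p =>
    ⟨⟨p.1.2.2, p.code⟩, Finset.mem_sigma.2 ⟨Finset.mem_univ _, p.code_mem hk hkn⟩⟩
  have he : Function.Injective e := fun p q h => by
    have h' := congrArg Subtype.val h
    simp only [e, Sigma.mk.injEq] at h'
    exact Idx13.eq_of_code_eq hk hkn h'.1 (eq_of_heq h'.2)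
  refine ⟨Finite.of_injective e he, (Nat.card_le_card_of_injective e he).trans
    (le_trans (le_of_eq ?_) (card_sigma_le_card_surjective hk hkn))⟩
  rw [Nat.card_eq_fintype_card, Fintype.card_coe, hA, Finset.card_sigma, Finset.card_sigma]
  refine Finset.sum_congr rfl fun w _ => ?_
  rw [Finset.card_powersetCard, Finset.card_powersetCard, Finset.card_range,
    Finset.card_sdiff_of_subset (show permDes w ⊆ Finset.Ico 1 n from Finset.filter_subset _ _), Nat.card_Ico]

end

section

variable {K : Type*} [Field K] {n : ℕ}

/-- Polynomials all of whose monomials have degree less than `d`. -/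
def degLT (K : Type*) [Field K] (n d : ℕ) : Submodule K (MvPolynomial (Fin n) K) :=
  restrictSupport K {e | e.degree < d}

lemma monomial_mul_mem_degLT {d : ℕ} (c : Fin n →₀ ℕ) (r : K) {f : MvPolynomial (Fin n) K}
    (hf : f ∈ degLT K n d) : monomial c r * f ∈ degLT K n (c.degree + d) := by
  intro e he
  have h1 : coeff e (monomial c r * f) ≠ 0 := mem_support_iff.1 (Finset.mem_coe.1 he)
  rw [coeff_monomial_mul'] at h1
  by_cases hce : c ≤ e
  · rw [if_pos hce] at h1
    have h2 : (e - c).degree < d :=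
      hf (Finset.mem_coe.2 (mem_support_iff.2 (right_ne_zero_of_mul h1)))
    have h3 := congrArg Finsupp.degree (add_tsub_cancel_of_le hce)
    rw [map_add] at h3
    change e.degree < c.degree + d
    omega
  · rw [if_neg hce] at h1
    exact absurd rfl h1

lemma mem_degLT_of_isHomogeneous {f : MvPolynomial (Fin n) K} {d d' : ℕ} (hf : f.IsHomogeneous d)
    (h : d < d') : f ∈ degLT K n d' := by
  intro e he
  have h1 : e.degree = d := by
    rw [Finsupp.degree_eq_weight_one]
    exact hf (mem_support_iff.1 (Finset.mem_coe.1 he))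
  change e.degree < d'
  omega

/-- If each homogeneous generator of an ideal is the top component of a polynomial in the
kernel of an algebra morphism, then so are the homogeneous components of the ideal. -/
lemma homogeneousComponent_mem_ker_sup {R : Type*} [CommRing R] [Algebra K R]
    (ev : MvPolynomial (Fin n) K →ₐ[K] R) {s : Set (MvPolynomial (Fin n) K)}
    (hs : ∀ g ∈ s, ∃ d, g.IsHomogeneous d ∧ g ∈ LinearMap.ker ev.toLinearMap ⊔ degLT K n d)
    {f : MvPolynomial (Fin n) K} (hf : f ∈ Ideal.span s) (d : ℕ) :
    homogeneousComponent d f ∈ LinearMap.ker ev.toLinearMap ⊔ degLT K n d := by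
  suffices h : ∀ a, homogeneousComponent d (a * f) ∈
      LinearMap.ker ev.toLinearMap ⊔ degLT K n d by simpa using h 1
  induction hf using Submodule.span_induction with
  | mem g hg =>
    intro a
    obtain ⟨e, hge, hg⟩ := hs g hg
    induction a using MvPolynomial.induction_on' with
    | monomial c r =>
      have hhom : (monomial c r * g).IsHomogeneous (c.degree + e) :=
        (isHomogeneous_monomial r rfl).mul hge
      rw [homogeneousComponent_of_mem ((mem_homogeneousSubmodule _ _).2 hhom)]
      split_ifs with hd
      · rw [hd]
        obtain ⟨x, hx, y, hy, hxy⟩ := Submodule.mem_sup.1 hg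
        rw [← hxy, mul_add]
        refine Submodule.add_mem_sup ?_ (monomial_mul_mem_degLT c r hy)
        rw [LinearMap.mem_ker, AlgHom.toLinearMap_apply] at hx ⊢
        rw [map_mul, hx, mul_zero]
      · exact Submodule.zero_mem _
    | add p q hp hq =>
      rw [add_mul, map_add]
      exact Submodule.add_mem _ hp hq
  | zero => simp
  | add x y _ _ hx hy =>
    intro a
    rw [mul_add, map_add]
    exact Submodule.add_mem _ (hx a) (hy a)
  | smul b x _ hx =>
    intro a
    rw [smul_eq_mul, ← mul_assoc]
    exact hx _

/-- A homogeneous family spanning modulo an ideal whose homogeneous components are top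
components of elements of `N` also spans modulo `N`. -/
lemma span_sup_eq_top_of_homogeneous {ι : Type*} {Q : ι → MvPolynomial (Fin n) K} {deg : ι → ℕ}
    (hQ : ∀ p, (Q p).IsHomogeneous (deg p)) {I N : Submodule K (MvPolynomial (Fin n) K)}
    (hspan : Submodule.span K (Set.range Q) ⊔ I = ⊤)
    (hI : ∀ f ∈ I, ∀ d, homogeneousComponent d f ∈ N ⊔ degLT K n d) :
    Submodule.span K (Set.range Q) ⊔ N = ⊤ := by
  have hcomp : ∀ d, ∀ f ∈ Submodule.span K (Set.range Q),
      homogeneousComponent d f ∈ Submodule.span K (Set.range Q) := by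
    intro d f hf
    induction hf using Submodule.span_induction with
    | mem g hg =>
      obtain ⟨p, rfl⟩ := hg
      rw [homogeneousComponent_of_mem ((mem_homogeneousSubmodule _ _).2 (hQ p))]
      split_ifs
      · exact Submodule.subset_span ⟨p, rfl⟩
      · exact Submodule.zero_mem _
    | zero => simp
    | add x y _ _ hx hy =>
      rw [map_add]
      exact Submodule.add_mem _ hx hy
    | smul b x _ hx =>
      rw [map_smul]
      exact Submodule.smul_mem _ _ hx
  have hdeg : ∀ d, degLT K n d ≤ Submodule.span K (Set.range Q) ⊔ N := by
    intro d
    induction d with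
    | zero =>
      exact fun f hf => mem_of_monomial_mem _ fun c hc => absurd (hf hc) (Nat.not_lt_zero _)
    | succ d ih =>
      refine fun f hf => mem_of_monomial_mem _ fun c hc => ?_
      rcases Nat.lt_succ_iff_lt_or_eq.1 (hf hc) with h | h
      · exact ih ((monomial_mem_restrictSupport K).2 (Or.inl h))
      · have htop : monomial c 1 ∈ Submodule.span K (Set.range Q) ⊔ I :=
          hspan ▸ Submodule.mem_top
        obtain ⟨x, hx, y, hy, hxy⟩ := Submodule.mem_sup.1 htop
        have h1 : monomial c (1 : K) = homogeneousComponent d x + homogeneousComponent d y := by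
          rw [← map_add, hxy, homogeneousComponent_of_mem
            ((mem_homogeneousSubmodule _ _).2 (isHomogeneous_monomial (1 : K) h)), if_pos rfl]
        rw [h1]
        exact Submodule.add_mem _ (Submodule.mem_sup_left (hcomp d x hx))
          (sup_le le_sup_right ih (hI y hy d))
  refine eq_top_iff.2 fun f _ => mem_of_monomial_mem _ fun c _ => hdeg (c.degree + 1) ?_
  exact (monomial_mem_restrictSupport K).2 (Or.inl (Nat.lt_succ_self _))

/-- Labelling of the positions of a surjection: first occurrences are labelled by the value,
the other positions by `k` plus the previous occurrence. -/
lemma exists_labelling {k : ℕ} {f : Fin n → Fin k} (hf : Function.Surjective f) :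
    ∃ idx : Fin n → ℕ, Function.Injective idx ∧ (∀ i, idx i < k + i) ∧
      (∀ v < k, ∃ i, idx i = v) ∧ (∀ i, idx i < k → (f i : ℕ) = idx i) ∧
      ∀ i, k ≤ idx i → ∃ j < i, idx i = k + j ∧ f j = f i := by
  set S : Fin n → Finset (Fin n) := fun i => Finset.univ.filter fun j => j < i ∧ f j = f i
  have hS : ∀ i j, j ∈ S i ↔ j < i ∧ f j = f i := fun i j => by simp [S]
  set idx : Fin n → ℕ := fun i => if h : (S i).Nonempty then k + (S i).max' h else f i with hidx
  have h1 : ∀ i, (h : (S i).Nonempty) → idx i = k + (S i).max' h := fun i h => by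
    simp [hidx, h]
  have h2 : ∀ i, ¬ (S i).Nonempty → idx i = f i := fun i h => by simp only [hidx, dif_neg h]
  have h3 : ∀ i, (h : (S i).Nonempty) → (S i).max' h < i ∧ f ((S i).max' h) = f i :=
    fun i h => (hS _ _).1 (Finset.max'_mem _ h)
  have hlt : ∀ i i', i < i' → idx i ≠ idx i' := by
    intro i i' hii' heq
    by_cases hi : (S i).Nonempty <;> by_cases hi' : (S i').Nonempty
    · rw [h1 i hi, h1 i' hi'] at heq
      have he : (S i).max' hi = (S i').max' hi' := Fin.ext (by omega)
      have hm : i ∈ S i' := (hS _ _).2 ⟨hii', by rw [← (h3 i hi).2, he, (h3 i' hi').2]⟩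
      have := Finset.le_max' _ _ hm
      rw [← he] at this
      exact this.not_gt (h3 i hi).1
    · rw [h1 i hi, h2 i' hi'] at heq
      omega
    · rw [h2 i hi, h1 i' hi'] at heq
      omega
    · rw [h2 i hi, h2 i' hi'] at heq
      exact hi' ⟨i, (hS _ _).2 ⟨hii', Fin.ext heq⟩⟩
  refine ⟨idx, fun i i' heq => ?_, fun i => ?_, fun v hv => ?_, fun i hi => ?_, fun i hi => ?_⟩
  · rcases lt_trichotomy i i' with h | h | h
    · exact absurd heq (hlt _ _ h)
    · exact h
    · exact absurd heq.symm (hlt _ _ h)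
  · by_cases hi : (S i).Nonempty
    · rw [h1 i hi]
      have : ((S i).max' hi : ℕ) < i := (h3 i hi).1
      omega
    · rw [h2 i hi]
      omega
  · have hne : (Finset.univ.filter fun i => f i = ⟨v, hv⟩).Nonempty := by
      obtain ⟨i, hi⟩ := hf ⟨v, hv⟩
      exact ⟨i, by simp [hi]⟩
    have hm := (Finset.mem_filter.1 (Finset.min'_mem _ hne)).2
    refine ⟨_, (h2 (Finset.min' _ hne) ?_).trans (by rw [hm])⟩
    rintro ⟨j, hj⟩
    have hj' := (hS _ _).1 hj
    exact (Finset.min'_le _ j (by simp [hj'.2, hm])).not_gt hj'.1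
  · by_cases h : (S i).Nonempty
    · rw [h1 i h] at hi
      omega
    · rw [h2 i h]
  · by_cases h : (S i).Nonempty
    · exact ⟨_, (h3 i h).1, h1 i h, (h3 i h).2⟩
    · rw [h2 i h] at hi
      omega

end

section

variable {K : Type*} [Field K] {n : ℕ}

lemma coeff_prod_one_add_eq_zero {ι : Type*} (r : ι → K) (s : Finset ι) :
    ∀ d, s.card < d →
      PowerSeries.coeff d (∏ i ∈ s, (1 + PowerSeries.C (r i) * PowerSeries.X)) = 0 := by
  induction s using Finset.induction_on with
  | empty =>
    intro d hd
    rw [Finset.prod_empty, PowerSeries.coeff_one, if_neg (by simpa using hd.ne')]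
  | insert a s ha ih =>
    intro d hd
    rw [Finset.card_insert_of_notMem ha] at hd
    obtain ⟨d, rfl⟩ := Nat.exists_eq_succ_of_ne_zero (Nat.ne_zero_of_lt hd)
    rw [Finset.prod_insert ha, add_mul, one_mul, map_add, mul_assoc, PowerSeries.coeff_C_mul,
      mul_comm PowerSeries.X, PowerSeries.coeff_succ_mul_X, ih _ (by omega), ih _ (by omega),
      mul_zero, add_zero]

lemma mk_eval_esymm (y : Fin n → K) :
    PowerSeries.mk (fun d => eval y (esymm (Fin n) K d)) =
      ∏ i, (1 + PowerSeries.C (y i) * PowerSeries.X) := by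
  ext d
  rw [PowerSeries.coeff_mk, Finset.prod_one_add, map_sum, esymm, map_sum,
    Finset.powersetCard_eq_filter, Finset.sum_filter]
  refine Finset.sum_congr rfl fun t _ => ?_
  rw [Finset.prod_mul_distrib, Finset.prod_const, ← map_prod, PowerSeries.coeff_C_mul_X_pow]
  simp [eq_comm, map_prod]

lemma prod_mul_mk_eval_hpoly (y : Fin n → K) : ∀ m ≤ n,
    (∏ i ∈ Finset.univ.filter (fun i : Fin n => (i : ℕ) < m),
      (1 + PowerSeries.C (-y i) * PowerSeries.X)) *
      PowerSeries.mk (fun d => eval y (hpoly K n d m)) = 1 := by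
  intro m
  induction m with
  | zero =>
    intro _
    ext d
    cases d with
    | zero => simp [hpoly_zero]
    | succ d => simp [hpoly_succ_zero, PowerSeries.coeff_one]
  | succ m ih =>
    intro hm
    refine Eq.trans ?_ (ih (by omega))
    have h1 : Finset.univ.filter (fun i : Fin n => (i : ℕ) < m + 1) =
        insert ⟨m, hm⟩ (Finset.univ.filter fun i : Fin n => (i : ℕ) < m) := by
      ext i
      simp [Fin.ext_iff]
      omega
    rw [h1, Finset.prod_insert (by simp), mul_comm (1 + _), mul_assoc]
    congr 1
    ext d
    rw [add_mul, one_mul, map_add, mul_assoc, PowerSeries.coeff_C_mul, mul_comm PowerSeries.X]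
    cases d with
    | zero => simp [hpoly_zero]
    | succ d =>
      rw [PowerSeries.coeff_succ_mul_X]
      simp [hpoly_succ_succ hm]

lemma isHomogeneous_esymm (d : ℕ) : (esymm (Fin n) K d).IsHomogeneous d := by
  refine IsHomogeneous.sum _ _ _ fun t ht => ?_
  have h := IsHomogeneous.prod t (fun i => (X i : MvPolynomial (Fin n) K)) (fun _ => 1)
    fun i _ => isHomogeneous_X K i
  rwa [Finset.sum_const, (Finset.mem_powersetCard.1 ht).2, smul_eq_mul, mul_one] at h

/-- Simultaneous evaluation at a family of points. -/
def evalAt {A : Type*} (y : A → Fin n → K) : MvPolynomial (Fin n) K →ₐ[K] A → K :=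
  AlgHom.pi fun a => aeval (y a)

lemma evalAt_apply {A : Type*} (y : A → Fin n → K) (f : MvPolynomial (Fin n) K) (a : A) :
    evalAt y f a = eval (y a) f := by
  rw [evalAt, AlgHom.pi_apply, aeval_eq_eval]

/-- If a fixed power series with constant term `1` kills the `d`-th coefficient of the generating
series of the values of `g` at all points, then `g d` is the top component of a polynomial
vanishing at all points. -/
lemma mem_ker_sup_degLT {A : Type*} (y : A → Fin n → K) (g : ℕ → MvPolynomial (Fin n) K)
    (hg : ∀ j, (g j).IsHomogeneous j) (U : PowerSeries K) (hU : PowerSeries.coeff 0 U = 1) (d : ℕ)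
    (h : ∀ a, PowerSeries.coeff d (U * PowerSeries.mk fun j => eval (y a) (g j)) = 0) :
    g d ∈ LinearMap.ker (evalAt y).toLinearMap ⊔
      degLT K n d := by
  have hsplit : ∀ {M : Type _} [AddCommMonoid M] (φ : ℕ × ℕ → M),
      ∑ p ∈ Finset.HasAntidiagonal.antidiagonal d, φ p =
        φ (0, d) + ∑ p ∈ (Finset.HasAntidiagonal.antidiagonal d).erase (0, d), φ p := fun φ =>
    (Finset.add_sum_erase _ _ (by simp)).symm
  set R := ∑ p ∈ (Finset.HasAntidiagonal.antidiagonal d).erase (0, d),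
    PowerSeries.coeff p.1 U • g p.2 with hR
  have h1 : g d = (g d + R) + -R := by ring
  rw [h1]
  refine Submodule.add_mem_sup ?_ (Submodule.neg_mem _ (Submodule.sum_mem _ fun p hp =>
    Submodule.smul_mem _ _ (mem_degLT_of_isHomogeneous (hg _) ?_)))
  · rw [LinearMap.mem_ker]
    funext a
    have h2 := h a
    rw [PowerSeries.coeff_mul, hsplit, hU] at h2
    simpa [hR, evalAt_apply, map_sum, smul_eval] using h2
  · obtain ⟨hp1, hp2⟩ := Finset.mem_erase.1 hp
    rw [Finset.HasAntidiagonal.mem_antidiagonal] at hp2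
    rcases Nat.eq_zero_or_pos p.1 with h0 | h0
    · exact absurd (Prod.ext h0 (by simp; omega)) hp1
    · omega

/-- Evaluation at finitely many distinct points is surjective. -/
lemma range_eval_eq_top {A : Type*} [Finite A] {y : A → Fin n → K} (hy : Function.Injective y) :
    LinearMap.range (evalAt y).toLinearMap = ⊤ := by
  have := Fintype.ofFinite A
  refine eq_top_iff.2 fun v _ => ?_
  have hsep : ∀ a b : A, ∃ f : MvPolynomial (Fin n) K,
      b ≠ a → eval (y a) f ≠ 0 ∧ eval (y b) f = 0 := by
    intro a b
    by_cases hab : b = a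
    · exact ⟨0, fun h => absurd hab h⟩
    · obtain ⟨i, hi⟩ := Function.ne_iff.1 (hy.ne hab)
      exact ⟨X i - C (y b i), fun _ => ⟨by simpa [sub_eq_zero] using hi.symm, by simp⟩⟩
  choose f hf using hsep
  set q : A → MvPolynomial (Fin n) K := fun a => ∏ b ∈ Finset.univ.erase a, f a b
  have hq : ∀ a, eval (y a) (q a) ≠ 0 := fun a => by
    rw [map_prod, Finset.prod_ne_zero_iff]
    exact fun b hb => (hf a b (Finset.ne_of_mem_erase hb)).1
  have hq' : ∀ a b, b ≠ a → eval (y b) (q a) = 0 := fun a b hb => by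
    rw [map_prod]
    exact Finset.prod_eq_zero (Finset.mem_erase.2 ⟨hb, Finset.mem_univ _⟩) (hf a b hb).2
  refine ⟨∑ a, (v a * (eval (y a) (q a))⁻¹) • q a, ?_⟩
  funext b
  have h1 : ∑ a, v a * (eval (y a) (q a))⁻¹ * eval (y b) (q a) = v b := by
    rw [Finset.sum_eq_single b]
    · rw [mul_assoc, inv_mul_cancel₀ (hq b), mul_one]
    · exact fun a _ hab => by rw [hq' a b hab.symm, mul_zero]
    · exact fun hb => absurd (Finset.mem_univ _) hb
  simpa [evalAt_apply, map_sum, smul_eval] using h1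

end

section

variable {K : Type*} [Field K] {n k : ℕ}

lemma constantCoeff_prod_one_add {ι : Type*} (r : ι → K) (s : Finset ι) :
    PowerSeries.constantCoeff (∏ i ∈ s, (1 + PowerSeries.C (r i) * PowerSeries.X)) = 1 := by
  simp [map_prod]

/-- Distinct surjections have distinct labellings. -/
lemma labelling_injective {f g : Fin n → Fin k} {idx : Fin n → ℕ}
    (hf : ∀ i, idx i < k → (f i : ℕ) = idx i)
    (hf' : ∀ i, k ≤ idx i → ∃ j < i, idx i = k + j ∧ f j = f i)
    (hg : ∀ i, idx i < k → (g i : ℕ) = idx i)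
    (hg' : ∀ i, k ≤ idx i → ∃ j < i, idx i = k + j ∧ g j = g i) : f = g := by
  funext i
  induction i using WellFoundedLT.induction with
  | _ i ih =>
    rcases lt_or_ge (idx i) k with h | h
    · exact Fin.ext ((hf i h).trans (hg i h).symm)
    · obtain ⟨j, hj, hij, hfj⟩ := hf' i h
      obtain ⟨j', -, hij', hgj⟩ := hg' i h
      obtain rfl : j = j' := Fin.ext (by omega)
      rw [← hfj, ← hgj, ih j hj]

lemma hpoly_mem_ker_sup_degLT {A : Type*} (a : ℕ → K) (idx : A → Fin n → ℕ)
    (hinj : ∀ f, Function.Injective (idx f)) (hlt : ∀ f i, idx f i < k + i) {m : ℕ} (hm : 1 ≤ m)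
    (hmn : m ≤ n) (hk : 1 ≤ k) :
    hpoly K n k m ∈ LinearMap.ker (evalAt fun f i => a (idx f i)).toLinearMap ⊔ degLT K n k := by
  refine mem_ker_sup_degLT _ (fun d => hpoly K n d m) (fun d => hpoly_isHomogeneous d m)
    (∏ j ∈ Finset.range (k + m - 1), (1 + PowerSeries.C (-a j) * PowerSeries.X)) ?_ k fun f => ?_
  · rw [PowerSeries.coeff_zero_eq_constantCoeff_apply,
      constantCoeff_prod_one_add (fun j => -a j)]
  · set s := Finset.univ.filter (fun i : Fin n => (i : ℕ) < m) with hs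
    have hcard : s.card = m := by
      rw [hs, Fin.card_filter_val_lt, min_eq_right hmn]
    have hsub : s.image (idx f) ⊆ Finset.range (k + m - 1) := by
      intro j hj
      obtain ⟨i, hi, rfl⟩ := Finset.mem_image.1 hj
      have h1 := (Finset.mem_filter.1 hi).2
      have h2 := hlt f i
      exact Finset.mem_range.2 (by omega)
    rw [← Finset.prod_sdiff hsub, Finset.prod_image fun _ _ _ _ h => hinj f h, mul_assoc,
      prod_mul_mk_eval_hpoly (fun i => a (idx f i)) m hmn, mul_one]
    refine coeff_prod_one_add_eq_zero (fun j => -a j) _ _ ?_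
    rw [Finset.card_sdiff_of_subset hsub, Finset.card_range,
      Finset.card_image_of_injective _ (hinj f), hcard]
    omega

lemma esymm_mem_ker_sup_degLT {A : Type*} (a : ℕ → K) (idx : A → Fin n → ℕ)
    (hinj : ∀ f, Function.Injective (idx f)) (hval : ∀ f, ∀ v < k, ∃ i, idx f i = v) {d : ℕ}
    (hd : n - k < d) :
    esymm (Fin n) K d ∈
      LinearMap.ker (evalAt fun f i => a (idx f i)).toLinearMap ⊔ degLT K n d := by
  have hU : PowerSeries.constantCoeff
      (∏ j ∈ Finset.range k, (1 + PowerSeries.C (a j) * PowerSeries.X)) = 1 :=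
    constantCoeff_prod_one_add a _
  refine mem_ker_sup_degLT _ (fun d => esymm (Fin n) K d) isHomogeneous_esymm
    (∏ j ∈ Finset.range k, (1 + PowerSeries.C (a j) * PowerSeries.X))⁻¹ ?_ d fun f => ?_
  · rw [PowerSeries.coeff_zero_eq_constantCoeff_apply, PowerSeries.constantCoeff_inv, hU, inv_one]
  · have hsub : Finset.range k ⊆ Finset.univ.image (idx f) := by
      intro v hv
      obtain ⟨i, hi⟩ := hval f v (Finset.mem_range.1 hv)
      exact Finset.mem_image.2 ⟨i, Finset.mem_univ _, hi⟩
    rw [mk_eval_esymm fun i => a (idx f i),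
      ← Finset.prod_image (f := fun j => 1 + PowerSeries.C (a j) * PowerSeries.X)
        fun _ _ _ _ h => hinj f h, ← Finset.prod_sdiff hsub, mul_left_comm,
      PowerSeries.inv_mul_cancel _ (by rw [hU]; exact one_ne_zero), mul_one]
    refine coeff_prod_one_add_eq_zero a _ _ ?_
    rw [Finset.card_sdiff_of_subset hsub, Finset.card_range,
      Finset.card_image_of_injective _ (hinj f), Finset.card_univ, Fintype.card_fin]
    exact hd

lemma card_surjective_le_of_infinite [Infinite K] (hk : 1 ≤ k) {ι : Type*} [Finite ι]
    {Q : ι → MvPolynomial (Fin n) K} {deg : ι → ℕ} (hQ : ∀ p, (Q p).IsHomogeneous (deg p))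
    (hspan : Submodule.span K (Set.range Q) ⊔ (Jideal K n k).restrictScalars K = ⊤) :
    Nat.card {f : Fin n → Fin k // Function.Surjective f} ≤ Nat.card ι := by
  have := Fintype.ofFinite ι
  choose idx hinj hlt hval hlow hhigh using
    fun f : {f : Fin n → Fin k // Function.Surjective f} => exists_labelling f.2
  set a := Infinite.natEmbedding K
  set ev := evalAt fun f i => a (idx f i)
  have hker := span_sup_eq_top_of_homogeneous (N := LinearMap.ker ev.toLinearMap) hQ hspan
    fun f hf d => homogeneousComponent_mem_ker_sup ev (fun g hg => by
      rcases hg with ⟨m, hm, hmn, rfl⟩ | ⟨d, hd, -, rfl⟩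
      · exact ⟨k, hpoly_isHomogeneous k m, hpoly_mem_ker_sup_degLT a idx hinj hlt hm hmn hk⟩
      · exact ⟨d, isHomogeneous_esymm d, esymm_mem_ker_sup_degLT a idx hinj hval hd⟩) hf d
  have hy : Function.Injective fun f i => a (idx f i) := by
    intro f g hfg
    have h1 : idx f = idx g := funext fun i => a.injective (congrFun hfg i)
    exact Subtype.ext (labelling_injective (hlow f) (hhigh f) (h1 ▸ hlow g) (h1 ▸ hhigh g))
  have htop := range_eval_eq_top hy
  rw [LinearMap.range_eq_map, ← hker, Submodule.map_sup,
    LinearMap.le_ker_iff_map.1 le_rfl, sup_bot_eq, Submodule.map_span,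
    ← Set.range_comp] at htop
  have h2 := finrank_range_le_card (R := K) (ev.toLinearMap ∘ Q)
  rw [Set.finrank, htop, finrank_top, Module.finrank_fintype_fun_eq_card] at h2
  rwa [Nat.card_eq_fintype_card, Nat.card_eq_fintype_card]

lemma map_hpoly {L : Type*} [Field L] (φ : K →+* L) (d m : ℕ) :
    map φ (hpoly K n d m) = hpoly L n d m := by
  rw [hpoly, hpoly, map_sum]
  refine Finset.sum_congr rfl fun s _ => ?_
  rw [map_multiset_prod, Multiset.map_map]
  simp [Function.comp_def]

lemma map_mem_Jideal {L : Type*} [Field L] (φ : K →+* L) {f : MvPolynomial (Fin n) K}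
    (hf : f ∈ Jideal K n k) : map φ f ∈ Jideal L n k := by
  have h : Ideal.map (map φ) (Jideal K n k) ≤ Jideal L n k := by
    rw [Jideal, Ideal.map_span, Ideal.span_le]
    rintro _ ⟨g, ⟨m, hm, hmn, rfl⟩ | ⟨d, hd, hdn, rfl⟩, rfl⟩
    · exact Ideal.subset_span (Or.inl ⟨m, hm, hmn, map_hpoly φ k m⟩)
    · exact Ideal.subset_span (Or.inr ⟨d, hd, hdn, map_esymm _ _ d φ⟩)
  exact h (Ideal.mem_map_of_mem _ hf)

/-- A homogeneous family spanning `S_{n,k}` has at least as many elements as there are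
surjections `[n] → [k]`. -/
lemma card_surjective_le (hk : 1 ≤ k) {ι : Type*} [Finite ι]
    {Q : ι → MvPolynomial (Fin n) K} {deg : ι → ℕ} (hQ : ∀ p, (Q p).IsHomogeneous (deg p))
    (hspan : Submodule.span K (Set.range Q) ⊔ (Jideal K n k).restrictScalars K = ⊤) :
    Nat.card {f : Fin n → Fin k // Function.Surjective f} ≤ Nat.card ι := by
  set φ := algebraMap K (AlgebraicClosure K)
  refine card_surjective_le_of_infinite (K := AlgebraicClosure K) hk
    (Q := fun p => map φ (Q p)) (fun p => (hQ p).map φ)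
    (eq_top_iff.2 fun f _ => mem_of_monomial_mem _ fun c _ => ?_)
  have h1 : monomial c (1 : K) ∈ Submodule.span K (Set.range Q) ⊔
      (Jideal K n k).restrictScalars K := hspan ▸ Submodule.mem_top
  obtain ⟨x, hx, y, hy, hxy⟩ := Submodule.mem_sup.1 h1
  have h2 : monomial c (1 : AlgebraicClosure K) = map φ x + map φ y := by
    rw [← map_add, hxy, map_monomial, map_one φ]
  rw [h2]
  refine Submodule.add_mem_sup ?_ (map_mem_Jideal φ hy)
  clear hxy h2
  induction hx using Submodule.span_induction with
  | mem g hg =>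
    obtain ⟨p, rfl⟩ := hg
    exact Submodule.subset_span ⟨p, rfl⟩
  | zero => simp
  | add x y _ _ hx hy =>
    rw [map_add]
    exact Submodule.add_mem _ hx hy
  | smul b x _ hx =>
    rw [smul_eq_C_mul, map_mul, map_C, ← smul_eq_C_mul]
    exact Submodule.smul_mem _ _ hx

end

/-- The polynomials `π̄_w(x_{α,i})`, for `(α,i) ∈ A_{n,k}` and
`Des(α) ⊆ Des(w) ⊆ Des(α ∪ i)`, descend to an `F`-basis of `S_{n,k}`; moreover each
`π̄_w(x_{α,i})` is homogeneous of degree `maj(α) + |i|`. -/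
theorem pibar_basis_Snk (F : Type*) [Field F] (n k : ℕ) (hk : 1 ≤ k) (hkn : k ≤ n)
    (P : Idx13 n k → MvPolynomial (Fin n) F)
    (hP : ∀ p : Idx13 n k,
      IsPibarApplied F n p.1.2.2 (xAI F n p.1.1 p.1.2.1) (P p)) :
    LinearIndependent F
      (fun p : Idx13 n k => Ideal.Quotient.mk (Jideal F n k) (P p)) ∧
    Submodule.span F
      (Set.range fun p : Idx13 n k => Ideal.Quotient.mk (Jideal F n k) (P p)) = ⊤ ∧
    ∀ p : Idx13 n k,
      (P p).IsHomogeneous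
        ((∑ j ∈ desComp p.1.1, j) + ∑ t ∈ Finset.range n, p.1.2.1 t) := by
  have hhom : ∀ p : Idx13 n k, (P p).IsHomogeneous
      ((∑ j ∈ desComp p.1.1, j) + ∑ t ∈ Finset.range n, p.1.2.1 t) := by
    intro p
    obtain ⟨L, g, hL, h0, hg, hp⟩ := hP p
    rw [← hp]
    exact hg.isHomogeneous hL.1 (h0 ▸ xAI_isHomogeneous _ _)
  set mk := (Ideal.Quotient.mkₐ F (Jideal F n k)).toLinearMap with hmk
  have hker : LinearMap.ker mk = (Jideal F n k).restrictScalars F := by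
    ext f
    exact Ideal.Quotient.eq_zero_iff_mem
  have hiff : ∀ {ι : Type} (Q : ι → MvPolynomial (Fin n) F),
      Submodule.span F (Set.range fun p => mk (Q p)) = ⊤ ↔
        Submodule.span F (Set.range Q) ⊔ (Jideal F n k).restrictScalars F = ⊤ := by
    intro ι Q
    have h1 : Submodule.span F (Set.range fun p => mk (Q p)) =
        (Submodule.span F (Set.range Q)).map mk := by
      rw [Submodule.map_span, ← Set.range_comp]
      rfl
    rw [h1, LinearMap.map_eq_top_iff (LinearMap.range_eq_top.2 Ideal.Quotient.mk_surjective), hker]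
  have hspan := (hiff P).2 (span_sup_Jideal_eq_top hk hkn P hP)
  obtain ⟨hfin, hcard⟩ := finite_idx_and_card_le hk hkn
  refine ⟨?_, hspan, hhom⟩
  rw [linearIndependent_iff_notMem_span]
  intro p₀ hp₀
  have hsub : Submodule.span F (Set.range fun p : {p // p ≠ p₀} => mk (P p)) = ⊤ := by
    have himage : (Set.range fun p : {p // p ≠ p₀} => mk (P p)) =
        (fun p => mk (P p)) '' (Set.univ \ {p₀}) := by
      ext x
      simp
    rw [himage, eq_top_iff, ← hspan, Submodule.span_le]
    rintro _ ⟨p, rfl⟩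
    by_cases hp : p = p₀
    · exact hp ▸ hp₀
    · exact Submodule.subset_span ⟨p, ⟨trivial, hp⟩, rfl⟩
  have hle := card_surjective_le hk (fun p : {p // p ≠ p₀} => hhom p) ((hiff _).1 hsub)
  have hlt : Nat.card {p // p ≠ p₀} < Nat.card (Idx13 n k) :=
    Finite.card_subtype_lt (x := p₀) (by simp)
  omega

end OSPHecke
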